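/- arXiv:1101.2085 — 11 statements merged into one kernel-verified Lean document; each statement's English description precedes it below -/
import Mathlib

section
/- For every operator ideal 𝔄 on Banach spaces, the family S(𝔄) = {S(𝔄)(F) : F a Banach space} of all 𝔄-sequences is a generating sequential structure; moreover, S(𝔄) is normal. -/
open Filter Topology Bornology Metric Set Pointwise

/-- A real Banach space: a complete normed real vector space. -/
class BanachR (E : Type) extends NormedAddCommGroup E, NormedSpace ℝ E, CompleteSpace E

/-- An operator ideal `𝔄` on (real) Banach spaces: to each pair of Banach spaces `E, F` it
assigns a subset `carrier E F` of the continuous linear operators `E →L[ℝ] F` such that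
(OI₁) `carrier E F` is a nonzero vector subspace of `L(E,F)` (nontriviality being encoded,
as usual, by membership of all rank-one operators), and
(OI₂) `R ∘ T ∘ S ∈ carrier E₀ F₀` whenever `S ∈ L(E₀,E)`, `T ∈ carrier E F`, `R ∈ L(F,F₀)`. -/
structure OperatorIdeal : Type 1 where
  carrier : ∀ (E F : Type) [BanachR E] [BanachR F], Set (E →L[ℝ] F)
  zero_mem : ∀ (E F : Type) [BanachR E] [BanachR F], (0 : E →L[ℝ] F) ∈ carrier E F
  add_mem : ∀ (E F : Type) [BanachR E] [BanachR F] (S T : E →L[ℝ] F),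
    S ∈ carrier E F → T ∈ carrier E F → S + T ∈ carrier E F
  smul_mem : ∀ (E F : Type) [BanachR E] [BanachR F] (c : ℝ) (T : E →L[ℝ] F),
    T ∈ carrier E F → c • T ∈ carrier E F
  rankOne_mem : ∀ (E F : Type) [BanachR E] [BanachR F] (f : E →L[ℝ] ℝ) (y : F),
    f.smulRight y ∈ carrier E F
  comp_mem : ∀ (E₀ E F F₀ : Type) [BanachR E₀] [BanachR E] [BanachR F] [BanachR F₀]
    (R : F →L[ℝ] F₀) (T : E →L[ℝ] F) (S : E₀ →L[ℝ] E),
    T ∈ carrier E F → R.comp (T.comp S) ∈ carrier E₀ F₀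

/-- An operator ideal is surjective if `T ∈ 𝔄(E,F)` whenever `T ∈ L(E,F)` and there is
`S ∈ 𝔄(E₀,F)` with `T(U_E) ⊆ S(U_{E₀})`. -/
def OperatorIdeal.Surjective (A : OperatorIdeal) : Prop :=
  ∀ (E₀ E F : Type) [BanachR E₀] [BanachR E] [BanachR F]
    (T : E →L[ℝ] F) (S : E₀ →L[ℝ] F), S ∈ A.carrier E₀ F →
    T '' closedBall 0 1 ⊆ S '' closedBall 0 1 → T ∈ A.carrier E F

/-- The surjective hull `𝔄^sur`: the intersection of all surjective operator ideals
containing `𝔄`. -/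
def OperatorIdeal.surHull (A : OperatorIdeal) (E F : Type) [BanachR E] [BanachR F] :
    Set (E →L[ℝ] F) :=
  {T | ∀ B : OperatorIdeal, B.Surjective →
    (∀ (E' F' : Type) [BanachR E'] [BanachR F'], A.carrier E' F' ⊆ B.carrier E' F') →
    T ∈ B.carrier E F}

/-- A generating sequential structure `Φ` on Banach spaces: each `Φ.mem F` is a vector
sequential structure of bounded sequences (closed under termwise linear combinations and
subsequences) satisfying (GS₁) `Φ_fin(F) ⊆ Φ(F) ⊆ Φ_b(F)` and (GS₂) every continuous linear
operator sends sequences of `Φ(E)` to bounded sequences with a subsequence in `Φ(F)`. -/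
structure GenSeqStruct : Type 1 where
  mem : ∀ (F : Type) [BanachR F], Set (ℕ → F)
  bounded_of_mem : ∀ (F : Type) [BanachR F] (x : ℕ → F), x ∈ mem F → IsBounded (range x)
  finDim_mem : ∀ (F : Type) [BanachR F] (x : ℕ → F), IsBounded (range x) →
    (∃ S : Submodule ℝ F, FiniteDimensional ℝ S ∧ ∀ n, x n ∈ S) → x ∈ mem F
  combo_mem : ∀ (F : Type) [BanachR F] (a b : ℝ) (x y : ℕ → F), x ∈ mem F → y ∈ mem F →
    (fun n => a • x n + b • y n) ∈ mem F
  subseq_mem : ∀ (F : Type) [BanachR F] (x : ℕ → F) (φ : ℕ → ℕ), StrictMono φ →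
    x ∈ mem F → x ∘ φ ∈ mem F
  map_mem : ∀ (E F : Type) [BanachR E] [BanachR F] (T : E →L[ℝ] F) (x : ℕ → E), x ∈ mem E →
    ∃ φ : ℕ → ℕ, StrictMono φ ∧ (fun n => T (x (φ n))) ∈ mem F

/-- A generating sequential structure is normal if it is stable under multiplication by
scalar sequences bounded by `1`. -/
def GenSeqStruct.Normal (Φ : GenSeqStruct) : Prop :=
  ∀ (F : Type) [BanachR F] (x : ℕ → F) (lam : ℕ → ℝ), x ∈ Φ.mem F → (∀ n, |lam n| ≤ 1) →
    (fun n => lam n • x n) ∈ Φ.mem F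

/-- `M^Φ_base(E)`: bounded sets every sequence of which has a subsequence in `Φ(E)`. -/
def MBase (Φ : GenSeqStruct) (E : Type) [BanachR E] : Set (Set E) :=
  {M | IsBounded M ∧ ∀ x : ℕ → E, (∀ n, x n ∈ M) →
    ∃ φ : ℕ → ℕ, StrictMono φ ∧ x ∘ φ ∈ Φ.mem E}

/-- `M^Φ(E)`: bounded sets whose circled (balanced) hull lies in `M^Φ_base(E)`. -/
def MPhi (Φ : GenSeqStruct) (E : Type) [BanachR E] : Set (Set E) :=
  {M | IsBounded M ∧ balancedHull ℝ M ∈ MBase Φ E}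

/-- The `𝔄`-sequences in `F`: bounded sequences of the form `{T xₙ}` with `T ∈ 𝔄(E,F)` and
`{xₙ}` a bounded sequence in some Banach space `E`. -/
def ASeq (A : OperatorIdeal) (F : Type) [BanachR F] : Set (ℕ → F) :=
  {y | IsBounded (range y) ∧ ∃ (E : Type) (_ : BanachR E) (x : ℕ → E) (T : E →L[ℝ] F),
    IsBounded (range x) ∧ T ∈ A.carrier E F ∧ ∀ n, T (x n) = y n}

/-- `O(Φ)(E,F)`: continuous linear operators sending every bounded sequence of `E` to a
sequence with a subsequence in `Φ(F)`. -/
def OPhi (Φ : GenSeqStruct) (E F : Type) [BanachR E] [BanachR F] : Set (E →L[ℝ] F) :=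
  {T | ∀ x : ℕ → E, IsBounded (range x) →
    ∃ φ : ℕ → ℕ, StrictMono φ ∧ (fun n => T (x (φ n))) ∈ Φ.mem F}

/-- `O(Φ/Ψ)(E,F)`: continuous linear operators sending every sequence of `Ψ(E)` to a
sequence with a subsequence in `Φ(F)`. -/
def OQuot (Φ Ψ : GenSeqStruct) (E F : Type) [BanachR E] [BanachR F] : Set (E →L[ℝ] F) :=
  {T | ∀ x : ℕ → E, x ∈ Ψ.mem E →
    ∃ φ : ℕ → ℕ, StrictMono φ ∧ (fun n => T (x (φ n))) ∈ Φ.mem F}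

/-- `O(M^Φ)(E,F)`: continuous linear operators mapping every norm-bounded subset of `E`
into a member of `M^Φ(F)`. -/
def OMPhi (Φ : GenSeqStruct) (E F : Type) [BanachR E] [BanachR F] : Set (E →L[ℝ] F) :=
  {T | ∀ B : Set E, IsBounded B → ∃ W ∈ MPhi Φ F, T '' B ⊆ W}

/-- `Φ(F) ≪ Ψ(F)`: `Ψ(F)` is coordinated to `Φ(F)`, i.e. a sequence of `Ψ(F)` fails to be
in `Φ(F)` exactly when it has a subsequence no further subsequence of which lies in `Φ(F)`. -/
def Coordinated (Φ Ψ : GenSeqStruct) (F : Type) [BanachR F] : Prop :=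
  ∀ x : ℕ → F, x ∈ Ψ.mem F →
    (x ∉ Φ.mem F ↔ ∃ φ : ℕ → ℕ, StrictMono φ ∧
      ∀ ψ : ℕ → ℕ, StrictMono ψ → (x ∘ φ) ∘ ψ ∉ Φ.mem F)

/-- The product of two Banach spaces, with the sup norm. -/
noncomputable instance BanachR.instProd (E F : Type) [BanachR E] [BanachR F] :
    BanachR (E × F) where

/-- A finite-dimensional subspace of a Banach space is a Banach space. -/
noncomputable abbrev BanachR.ofFiniteDimensional {F : Type} [BanachR F] (S : Submodule ℝ F)
    [FiniteDimensional ℝ S] : BanachR S where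
  toCompleteSpace := FiniteDimensional.complete ℝ S

theorem isBounded_range_iff_exists_norm_le {E : Type*} [SeminormedAddCommGroup E] {x : ℕ → E} :
    IsBounded (range x) ↔ ∃ C, ∀ n, ‖x n‖ ≤ C := by
  simp [isBounded_iff_forall_norm_le]

namespace OperatorIdeal

variable (A : OperatorIdeal)

theorem comp_right_mem {E₀ E F : Type} [BanachR E₀] [BanachR E] [BanachR F]
    {T : E →L[ℝ] F} (hT : T ∈ A.carrier E F) (S : E₀ →L[ℝ] E) : T.comp S ∈ A.carrier E₀ F := by
  simpa using A.comp_mem E₀ E F F (ContinuousLinearMap.id ℝ F) T S hT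

theorem comp_left_mem {E F F₀ : Type} [BanachR E] [BanachR F] [BanachR F₀]
    {T : E →L[ℝ] F} (hT : T ∈ A.carrier E F) (R : F →L[ℝ] F₀) : R.comp T ∈ A.carrier E F₀ := by
  simpa using A.comp_mem E E F F₀ R T (ContinuousLinearMap.id ℝ E) hT

theorem sum_mem {E F : Type} [BanachR E] [BanachR F] {ι : Type*} (s : Finset ι)
    (T : ι → E →L[ℝ] F) (hT : ∀ i ∈ s, T i ∈ A.carrier E F) :
    ∑ i ∈ s, T i ∈ A.carrier E F :=
  Finset.sum_induction T (· ∈ A.carrier E F) (A.add_mem E F) (A.zero_mem E F) hT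

/-- Every operator with finite-dimensional domain belongs to every operator ideal. -/
theorem mem_of_finiteDimensional {E F : Type} [BanachR E] [BanachR F] [FiniteDimensional ℝ E]
    (T : E →L[ℝ] F) : T ∈ A.carrier E F := by
  let b := Module.finBasis ℝ E
  have hT : T = ∑ i, (LinearMap.toContinuousLinearMap (b.coord i)).smulRight (T (b i)) := by
    ext v
    conv_lhs => rw [← b.sum_repr v]
    simp [-Module.Basis.sum_repr]
  rw [hT]
  exact A.sum_mem _ _ fun i _ => A.rankOne_mem E F _ _

variable {A}

theorem apply_mem_aSeq {E F : Type} [BanachR E] [BanachR F] {T : E →L[ℝ] F}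
    (hT : T ∈ A.carrier E F) {x : ℕ → E} (hx : IsBounded (range x)) :
    (fun n => T (x n)) ∈ ASeq A F := by
  refine ⟨?_, E, inferInstance, x, T, hx, hT, fun _ => rfl⟩
  have h := T.lipschitz.isBounded_image hx
  rwa [← range_comp] at h

theorem exists_eq_of_mem_aSeq {F : Type} [BanachR F] {y : ℕ → F} (hy : y ∈ ASeq A F) :
    ∃ (E : Type) (_ : BanachR E) (x : ℕ → E) (T : E →L[ℝ] F),
      IsBounded (range x) ∧ T ∈ A.carrier E F ∧ y = fun n => T (x n) := by
  obtain ⟨-, E, hE, x, T, hx, hT, h⟩ := hy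
  exact ⟨E, hE, x, T, hx, hT, funext fun n => (h n).symm⟩

theorem mem_aSeq_of_finiteDimensional {F : Type} [BanachR F] {x : ℕ → F}
    (hx : IsBounded (range x)) (S : Submodule ℝ F) [FiniteDimensional ℝ S] (hS : ∀ n, x n ∈ S) :
    x ∈ ASeq A F := by
  let := BanachR.ofFiniteDimensional S
  refine apply_mem_aSeq (A.mem_of_finiteDimensional S.subtypeL) (x := fun n => ⟨x n, hS n⟩) ?_
  rw [isBounded_range_iff_exists_norm_le] at hx ⊢
  exact hx

theorem combo_mem_aSeq {F : Type} [BanachR F] (a b : ℝ) {x y : ℕ → F}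
    (hx : x ∈ ASeq A F) (hy : y ∈ ASeq A F) : (fun n => a • x n + b • y n) ∈ ASeq A F := by
  obtain ⟨E₁, _, u, T, hu, hT, rfl⟩ := exists_eq_of_mem_aSeq hx
  obtain ⟨E₂, _, v, S, hv, hS, rfl⟩ := exists_eq_of_mem_aSeq hy
  have hmem := A.add_mem _ _ _ _
    (A.smul_mem _ _ a _ (A.comp_right_mem hT (ContinuousLinearMap.fst ℝ E₁ E₂)))
    (A.smul_mem _ _ b _ (A.comp_right_mem hS (ContinuousLinearMap.snd ℝ E₁ E₂)))
  refine apply_mem_aSeq hmem (x := fun n => (u n, v n)) ((hu.prod hv).subset ?_)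
  rintro _ ⟨n, rfl⟩
  exact ⟨mem_range_self n, mem_range_self n⟩

theorem comp_mem_aSeq {F : Type} [BanachR F] {x : ℕ → F} (hx : x ∈ ASeq A F) (φ : ℕ → ℕ) :
    x ∘ φ ∈ ASeq A F := by
  obtain ⟨E, _, u, T, hu, hT, rfl⟩ := exists_eq_of_mem_aSeq hx
  exact apply_mem_aSeq hT (hu.subset (range_comp_subset_range φ u))

theorem map_mem_aSeq {E F : Type} [BanachR E] [BanachR F] (R : E →L[ℝ] F) {x : ℕ → E}
    (hx : x ∈ ASeq A E) : (fun n => R (x n)) ∈ ASeq A F := by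
  obtain ⟨E₀, _, u, T, hu, hT, rfl⟩ := exists_eq_of_mem_aSeq hx
  exact apply_mem_aSeq (A.comp_left_mem hT R) hu

theorem smul_mem_aSeq {F : Type} [BanachR F] {x : ℕ → F} {c : ℕ → ℝ} (hx : x ∈ ASeq A F)
    (hc : ∀ n, |c n| ≤ 1) : (fun n => c n • x n) ∈ ASeq A F := by
  obtain ⟨E, _, u, T, hu, hT, rfl⟩ := exists_eq_of_mem_aSeq hx
  obtain ⟨C, hC⟩ := isBounded_range_iff_exists_norm_le.1 hu
  have hcu : IsBounded (range fun n => c n • u n) :=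
    isBounded_range_iff_exists_norm_le.2 ⟨C, fun n => by
      rw [norm_smul, Real.norm_eq_abs]
      exact (mul_le_of_le_one_left (norm_nonneg _) (hc n)).trans (hC n)⟩
  simpa only [map_smul] using apply_mem_aSeq hT hcu

variable (A)

/-- The generating sequential structure of all `A`-sequences. -/
def genSeqStruct : GenSeqStruct where
  mem F _ := ASeq A F
  bounded_of_mem _ _ _ hx := hx.1
  finDim_mem _ _ _ hx := fun ⟨S, _, hS⟩ => mem_aSeq_of_finiteDimensional hx S hS
  combo_mem _ _ a b _ _ hx hy := combo_mem_aSeq a b hx hy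
  subseq_mem _ _ _ φ _ hx := comp_mem_aSeq hx φ
  map_mem _ _ _ _ R _ hx := ⟨id, strictMono_id, map_mem_aSeq R hx⟩

end OperatorIdeal

/-- For every operator ideal `𝔄` on Banach spaces, the family
`S(𝔄)` of all `𝔄`-sequences is a generating sequential structure, and it is normal. -/
theorem aSeq_isGenSeqStruct_and_normal (A : OperatorIdeal) :
    ∃ Φ : GenSeqStruct, (∀ (F : Type) [BanachR F], Φ.mem F = ASeq A F) ∧ Φ.Normal :=
  ⟨A.genSeqStruct, fun _ _ => rfl, fun _ _ _ _ hx hc => OperatorIdeal.smul_mem_aSeq hx hc⟩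
end

section
/- For every generating sequential structure Φ on Banach spaces, the family M^Φ = {M^Φ(E) : E a Banach space} is a generating bornology; in particular, each M^Φ(E) is a vector bornology (closed under subsets, finite sums, scalar multiples and circled hulls), M^Φ(E) contains all convex hulls of finite sets and consists of norm-bounded sets, and every continuous linear operator T : E → F between Banach spaces maps members of M^Φ(E) to members of M^Φ(F). -/
open Filter Topology Bornology Metric Set Pointwise

section GeneratingBornology

variable {Φ : GenSeqStruct} {E F : Type} [BanachR E] [BanachR F]

theorem MBase.mono {M A : Set E} (hM : M ∈ MBase Φ E) (hA : A ⊆ M) : A ∈ MBase Φ E :=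
  ⟨hM.1.subset hA, fun x hx => hM.2 x fun n => hA (hx n)⟩

theorem MBase.add {M N : Set E} (hM : M ∈ MBase Φ E) (hN : N ∈ MBase Φ E) :
    M + N ∈ MBase Φ E := by
  refine ⟨isBounded_add hM.1 hN.1, fun x hx => ?_⟩
  choose u hu v hv huv using fun n => Set.mem_add.1 (hx n)
  obtain ⟨φ, hφ, hφu⟩ := hM.2 u hu
  obtain ⟨ψ, hψ, hψv⟩ := hN.2 (v ∘ φ) fun n => hv (φ n)
  refine ⟨φ ∘ ψ, hφ.comp hψ, ?_⟩
  have h := Φ.combo_mem E 1 1 _ _ (Φ.subseq_mem E _ ψ hψ hφu) hψv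
  have e : x ∘ φ ∘ ψ =
      fun n => (1 : ℝ) • ((u ∘ φ) ∘ ψ) n + (1 : ℝ) • ((v ∘ φ) ∘ ψ) n := by
    funext n
    simp [huv]
  rwa [e]

theorem MBase.image {M : Set E} (hM : M ∈ MBase Φ E) (T : E →L[ℝ] F) :
    T '' M ∈ MBase Φ F := by
  refine ⟨T.lipschitz.isBounded_image hM.1, fun y hy => ?_⟩
  choose x hx hxy using hy
  obtain ⟨φ, hφ, hφx⟩ := hM.2 x hx
  obtain ⟨ψ, hψ, hψx⟩ := Φ.map_mem E F T _ hφx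
  refine ⟨φ ∘ ψ, hφ.comp hψ, ?_⟩
  simpa only [Function.comp_def, hxy] using hψx

theorem mBase_of_subset_finiteDimensional {M : Set E} (hM : IsBounded M) (S : Submodule ℝ E)
    [FiniteDimensional ℝ S] (hS : M ⊆ S) : M ∈ MBase Φ E :=
  ⟨hM, fun x hx => ⟨id, strictMono_id, Φ.finDim_mem E x
    (hM.subset (range_subset_iff.2 hx)) ⟨S, inferInstance, fun n => hS (hx n)⟩⟩⟩

theorem mPhi_of_subset_balanced {A B : Set E} (hAB : A ⊆ B) (hB : Balanced ℝ B)
    (hBase : B ∈ MBase Φ E) : A ∈ MPhi Φ E :=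
  ⟨hBase.1.subset hAB, MBase.mono hBase (hB.balancedHull_subset_of_subset hAB)⟩

theorem MPhi.image {M : Set E} (hM : M ∈ MPhi Φ E) (T : E →L[ℝ] F) : T '' M ∈ MPhi Φ F := by
  refine mPhi_of_subset_balanced (image_mono (subset_balancedHull ℝ)) ?_ (MBase.image hM.2 T)
  rintro a ha _ ⟨_, ⟨x, hx, rfl⟩, rfl⟩
  exact ⟨a • x, balancedHull.balanced M a ha (smul_mem_smul_set hx), map_smul T a x⟩

theorem convexHull_finset_mem_mPhi (s : Finset E) :
    convexHull ℝ (s : Set E) ∈ MPhi Φ E := by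
  obtain ⟨r, hr⟩ := (isBounded_convexHull.2 s.finite_toSet.isBounded).subset_closedBall (0 : E)
  have : FiniteDimensional ℝ (Submodule.span ℝ (s : Set E)) :=
    FiniteDimensional.span_finset ℝ s
  refine mPhi_of_subset_balanced
    (B := closedBall 0 r ∩ (Submodule.span ℝ (s : Set E) : Set E))
    (subset_inter hr (convexHull_min Submodule.subset_span (Submodule.convex _)))
    (balanced_closedBall_zero.inter ?_)
    (mBase_of_subset_finiteDimensional (isBounded_closedBall.subset inter_subset_left)
      (Submodule.span ℝ (s : Set E)) inter_subset_right)
  rintro a - _ ⟨x, hx, rfl⟩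
  exact Submodule.smul_mem _ a hx

end GeneratingBornology

/-- For every generating sequential structure `Φ`, the family `M^Φ` is a
generating bornology: each `M^Φ(E)` is closed under subsets, finite sums, scalar multiples
and circled hulls, contains all convex hulls of finite sets, consists of norm-bounded sets,
and every continuous linear operator maps members of `M^Φ(E)` to members of `M^Φ(F)`. -/
theorem mPhi_isGeneratingBornology (Φ : GenSeqStruct)
    (E F : Type) [BanachR E] [BanachR F] :
    (∀ M ∈ MPhi Φ E, ∀ A : Set E, A ⊆ M → A ∈ MPhi Φ E) ∧
    (∀ M ∈ MPhi Φ E, ∀ N ∈ MPhi Φ E, M + N ∈ MPhi Φ E) ∧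
    (∀ M ∈ MPhi Φ E, ∀ c : ℝ, c • M ∈ MPhi Φ E) ∧
    (∀ M ∈ MPhi Φ E, balancedHull ℝ M ∈ MPhi Φ E) ∧
    (∀ s : Finset E, convexHull ℝ (↑s : Set E) ∈ MPhi Φ E) ∧
    (∀ M ∈ MPhi Φ E, IsBounded M) ∧
    (∀ T : E →L[ℝ] F, ∀ M ∈ MPhi Φ E, T '' M ∈ MPhi Φ F) := by
  refine ⟨fun M hM A hA => ?_, fun M hM N hN => ?_, fun M hM c => ?_, fun M hM => ?_,
    convexHull_finset_mem_mPhi, fun M hM => hM.1, fun T M hM => MPhi.image hM T⟩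
  · exact mPhi_of_subset_balanced (hA.trans (subset_balancedHull ℝ))
      (balancedHull.balanced M) hM.2
  · exact mPhi_of_subset_balanced
      (add_subset_add (subset_balancedHull ℝ) (subset_balancedHull ℝ))
      ((balancedHull.balanced M).add (balancedHull.balanced N)) (MBase.add hM.2 hN.2)
  · exact MPhi.image hM (c • ContinuousLinearMap.id ℝ E)
  · exact mPhi_of_subset_balanced Subset.rfl (balancedHull.balanced M) hM.2
end

section
/- For every generating sequential structure Φ on Banach spaces, the family O(Φ) = {O(Φ)(E,F) : E, F Banach spaces} is a surjective operator ideal. -/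
open Filter Topology Bornology Metric Set Pointwise

namespace GenSeqStruct

variable (Φ : GenSeqStruct) {E F G : Type} [BanachR E] [BanachR F] [BanachR G]

theorem exists_comp_seq_mem {T : E →L[ℝ] F} (hT : T ∈ OPhi Φ E F) (S : G →L[ℝ] E) {x : ℕ → G}
    (hx : IsBounded (range x)) :
    ∃ φ : ℕ → ℕ, StrictMono φ ∧ (fun n => T (S (x (φ n)))) ∈ Φ.mem F := by
  refine hT (fun n => S (x n)) ?_
  have := S.lipschitz.isBounded_image hx
  rwa [← range_comp] at this

theorem smulRight_mem_oPhi (f : E →L[ℝ] ℝ) (y : F) : f.smulRight y ∈ OPhi Φ E F := by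
  intro x hx
  refine ⟨id, strictMono_id, Φ.finDim_mem F _ ?_ ⟨Submodule.span ℝ {y}, inferInstance, fun n => ?_⟩⟩
  · have := (f.smulRight y).lipschitz.isBounded_image hx
    rwa [← range_comp] at this
  · exact Submodule.smul_mem _ _ (Submodule.mem_span_singleton_self y)

theorem linearCombination_mem_oPhi {S T : E →L[ℝ] F} (hS : S ∈ OPhi Φ E F)
    (hT : T ∈ OPhi Φ E F) (a b : ℝ) : a • S + b • T ∈ OPhi Φ E F := by
  intro x hx
  obtain ⟨φ, hφ, hSφ⟩ := hS x hx
  obtain ⟨ψ, hψ, hTψ⟩ := hT (x ∘ φ) (hx.subset (range_comp_subset_range φ x))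
  exact ⟨φ ∘ ψ, hφ.comp hψ, Φ.combo_mem F a b _ _ (Φ.subseq_mem F _ ψ hψ hSφ) hTψ⟩

theorem comp_mem_oPhi {H : Type} [BanachR H] (R : F →L[ℝ] H) {T : E →L[ℝ] F}
    (hT : T ∈ OPhi Φ E F) (S : G →L[ℝ] E) : R.comp (T.comp S) ∈ OPhi Φ G H := by
  intro x hx
  obtain ⟨φ, hφ, hTφ⟩ := Φ.exists_comp_seq_mem hT S hx
  obtain ⟨ψ, hψ, hRψ⟩ := Φ.map_mem F H R _ hTφ
  exact ⟨φ ∘ ψ, hφ.comp hψ, hRψ⟩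

/-- The operator ideal `O(Φ)`. -/
def oPhiIdeal : OperatorIdeal where
  carrier E F _ _ := OPhi Φ E F
  zero_mem E F _ _ := by
    have := Φ.smulRight_mem_oPhi (0 : E →L[ℝ] ℝ) (0 : F)
    rwa [ContinuousLinearMap.smulRight_zero] at this
  add_mem E F _ _ S T hS hT := by
    simpa only [one_smul] using Φ.linearCombination_mem_oPhi hS hT 1 1
  smul_mem E F _ _ c T hT := by
    simpa only [zero_smul, add_zero] using Φ.linearCombination_mem_oPhi hT hT c 0
  rankOne_mem E F _ _ f y := Φ.smulRight_mem_oPhi f y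
  comp_mem E₀ E F F₀ _ _ _ _ R T S hT := Φ.comp_mem_oPhi R hT S

theorem oPhiIdeal_surjective : Φ.oPhiIdeal.Surjective := by
  intro E₀ E F _ _ _ T S hS hTS x hx
  obtain ⟨C, hC, hxC⟩ := hx.exists_pos_norm_le
  have lift (n : ℕ) : ∃ y ∈ closedBall (0 : E₀) 1, S y = T (C⁻¹ • x n) := by
    refine hTS (mem_image_of_mem T ?_)
    rw [mem_closedBall_zero_iff, norm_smul, norm_inv, Real.norm_of_nonneg hC.le,
      inv_mul_le_one₀ hC]
    exact hxC _ (mem_range_self n)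
  choose y hy hSy using lift
  obtain ⟨φ, hφ, hSφ⟩ := Φ.exists_comp_seq_mem hS (C • ContinuousLinearMap.id ℝ E₀)
    (isBounded_closedBall.subset (range_subset_iff.2 hy))
  refine ⟨φ, hφ, ?_⟩
  convert hSφ using 2 with n
  simp [hSy, hC.ne']

end GenSeqStruct

/-- For every generating sequential structure `Φ`, the family `O(Φ)` is a
surjective operator ideal. -/
theorem oPhi_isSurjectiveOperatorIdeal (Φ : GenSeqStruct) :
    ∃ A : OperatorIdeal, A.Surjective ∧
      ∀ (E F : Type) [BanachR E] [BanachR F], A.carrier E F = OPhi Φ E F := by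
  exact ⟨Φ.oPhiIdeal, Φ.oPhiIdeal_surjective, fun _ _ _ _ => rfl⟩
end

section
/- For every generating sequential structure Φ on Banach spaces and all Banach spaces E, F, a continuous linear operator T : E → F belongs to O(Φ)(E,F) if and only if T maps every norm-bounded subset of E into a member of M^Φ(F); that is, O(Φ) = O(M^Φ). -/
open Filter Topology Bornology Metric Set Pointwise

/-- A balanced bounded set in `M^Φ_base(F)` lies in `M^Φ(F)`. -/
theorem MBase.mem_MPhi_of_balanced {Φ : GenSeqStruct} {F : Type} [BanachR F] {M : Set F}
    (hM : M ∈ MBase Φ F) (hbal : Balanced ℝ M) : M ∈ MPhi Φ F := by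
  refine ⟨hM.1, ?_⟩
  rwa [(hbal.balancedHull_subset_of_subset Subset.rfl).antisymm (subset_balancedHull ℝ)]

/-- An operator of `O(Φ)(E,F)` maps bounded sets into `M^Φ_base(F)`. -/
theorem image_mem_MBase {Φ : GenSeqStruct} {E F : Type} [BanachR E] [BanachR F]
    {T : E →L[ℝ] F} (hT : T ∈ OPhi Φ E F) {B : Set E} (hB : IsBounded B) :
    T '' B ∈ MBase Φ F := by
  refine ⟨T.lipschitz.isBounded_image hB, fun y hy => ?_⟩
  choose x hxB hxy using hy
  obtain ⟨φ, hφ, hmem⟩ := hT x (hB.subset (range_subset_iff.2 hxB))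
  refine ⟨φ, hφ, ?_⟩
  simpa only [hxy, Function.comp_def] using hmem

/-- For every generating sequential structure `Φ` and Banach spaces
`E, F`, a continuous linear operator `T : E → F` belongs to `O(Φ)(E,F)` iff `T` maps
every norm-bounded subset of `E` into a member of `M^Φ(F)`; that is, `O(Φ) = O(M^Φ)`. -/
theorem oPhi_eq_oMPhi (Φ : GenSeqStruct) (E F : Type) [BanachR E] [BanachR F]
    (T : E →L[ℝ] F) :
    T ∈ OPhi Φ E F ↔ ∀ B : Set E, IsBounded B → ∃ W ∈ MPhi Φ F, T '' B ⊆ W := by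
  constructor
  · intro hT B hB
    obtain ⟨r, hr⟩ := hB.subset_closedBall 0
    have hbal : Balanced ℝ (T '' closedBall 0 r) := by
      rintro a ha _ ⟨_, ⟨x, hx, rfl⟩, rfl⟩
      exact ⟨a • x, balanced_closedBall_zero a ha (smul_mem_smul_set hx), map_smul T a x⟩
    exact ⟨T '' closedBall 0 r,
      MBase.mem_MPhi_of_balanced (image_mem_MBase hT isBounded_closedBall) hbal,
      image_mono hr⟩
  · intro h x hx
    obtain ⟨W, hW, hTW⟩ := h (range x) hx
    exact hW.2.2 (fun n => T (x n)) fun n =>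
      subset_balancedHull ℝ (hTW (mem_image_of_mem T (mem_range_self n)))
end

section
/- For any two generating sequential structures Φ, Ψ on Banach spaces, the family O(Φ/Ψ) = {O(Φ/Ψ)(E,F) : E, F Banach spaces} is an operator ideal. -/
open Filter Topology Bornology Metric Set Pointwise

/-- Every rank-one operator sends bounded sequences to sequences of any generating sequential
structure. -/
theorem GenSeqStruct.smulRight_mem (Φ : GenSeqStruct) {E F : Type} [BanachR E] [BanachR F]
    (f : E →L[ℝ] ℝ) (y : F) {x : ℕ → E} (hx : IsBounded (range x)) :
    (fun n => f.smulRight y (x n)) ∈ Φ.mem F := by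
  refine Φ.finDim_mem F _ ?_ ⟨ℝ ∙ y, inferInstance, fun n => ?_⟩
  · have h := (f.smulRight y).lipschitz.isBounded_image hx
    rwa [← range_comp] at h
  · exact Submodule.smul_mem _ _ (Submodule.mem_span_singleton_self y)

theorem OQuot.add_mem {Φ Ψ : GenSeqStruct} {E F : Type} [BanachR E] [BanachR F]
    {S T : E →L[ℝ] F} (hS : S ∈ OQuot Φ Ψ E F) (hT : T ∈ OQuot Φ Ψ E F) :
    S + T ∈ OQuot Φ Ψ E F := by
  intro x hx
  obtain ⟨φ, hφ, h₁⟩ := hS x hx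
  obtain ⟨ψ, hψ, h₂⟩ := hT (x ∘ φ) (Ψ.subseq_mem E x φ hφ hx)
  refine ⟨φ ∘ ψ, hφ.comp hψ, ?_⟩
  simpa using Φ.combo_mem F 1 1 _ _ (Φ.subseq_mem F _ ψ hψ h₁) h₂

theorem OQuot.smul_mem {Φ Ψ : GenSeqStruct} {E F : Type} [BanachR E] [BanachR F]
    (c : ℝ) {T : E →L[ℝ] F} (hT : T ∈ OQuot Φ Ψ E F) : c • T ∈ OQuot Φ Ψ E F := by
  intro x hx
  obtain ⟨φ, hφ, h⟩ := hT x hx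
  exact ⟨φ, hφ, by simpa using Φ.combo_mem F c 0 _ _ h h⟩

theorem OQuot.smulRight_mem {Φ Ψ : GenSeqStruct} {E F : Type} [BanachR E] [BanachR F]
    (f : E →L[ℝ] ℝ) (y : F) : f.smulRight y ∈ OQuot Φ Ψ E F := fun x hx =>
  ⟨id, strictMono_id, Φ.smulRight_mem f y (Ψ.bounded_of_mem E x hx)⟩

theorem OQuot.comp_mem {Φ Ψ : GenSeqStruct} {E₀ E F F₀ : Type}
    [BanachR E₀] [BanachR E] [BanachR F] [BanachR F₀]
    (R : F →L[ℝ] F₀) {T : E →L[ℝ] F} (S : E₀ →L[ℝ] E) (hT : T ∈ OQuot Φ Ψ E F) :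
    R.comp (T.comp S) ∈ OQuot Φ Ψ E₀ F₀ := by
  intro x hx
  obtain ⟨φ, hφ, h₁⟩ := Ψ.map_mem E₀ E S x hx
  obtain ⟨ψ, hψ, h₂⟩ := hT _ h₁
  obtain ⟨χ, hχ, h₃⟩ := Φ.map_mem F F₀ R _ h₂
  exact ⟨φ ∘ ψ ∘ χ, hφ.comp (hψ.comp hχ), h₃⟩

/-- For any two generating sequential structures `Φ, Ψ` on Banach spaces,
the family `O(Φ/Ψ)` is an operator ideal. -/
theorem oQuot_isOperatorIdeal (Φ Ψ : GenSeqStruct) :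
    ∃ A : OperatorIdeal,
      ∀ (E F : Type) [BanachR E] [BanachR F], A.carrier E F = OQuot Φ Ψ E F := by
  refine ⟨{
    carrier := fun E F _ _ => OQuot Φ Ψ E F
    zero_mem := fun E F _ _ => ?_
    add_mem := fun _ _ _ _ _ _ => OQuot.add_mem
    smul_mem := fun _ _ _ _ c _ => OQuot.smul_mem c
    rankOne_mem := fun _ _ _ _ => OQuot.smulRight_mem
    comp_mem := fun _ _ _ _ _ _ _ _ R _ S => OQuot.comp_mem R S }, fun _ _ _ _ => rfl⟩
  simpa using OQuot.smul_mem 0 (OQuot.smulRight_mem (0 : E →L[ℝ] ℝ) (0 : F))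
end

section
/- A bounded subset W of a Banach space F is limited if and only if every sequence in W has a limited subsequence. -/
open Filter Topology Bornology Set

variable {F : Type*} [NormedAddCommGroup F] [NormedSpace ℝ F] [CompleteSpace F]

/-- A sequence of continuous linear functionals is weak*-null if it tends to zero
pointwise on `F`. -/
def WeakStarNull (y' : ℕ → F →L[ℝ] ℝ) : Prop :=
  ∀ x : F, Tendsto (fun n => y' n x) atTop (𝓝 0)

/-- A (bounded) set `W` is limited if `supₐ∈W |y'ₙ(a)| → 0` for every weak*-null
sequence `{y'ₙ}` in `F'`. -/
def LimitedSet (W : Set F) : Prop :=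
  ∀ y' : ℕ → F →L[ℝ] ℝ, WeakStarNull y' →
    Tendsto (fun n => ⨆ a : W, |y' n a|) atTop (𝓝 0)

/-- A (bounded) sequence `{xₙ}` is limited if `⟨xₙ, x'ₙ⟩ → 0` for every weak*-null
sequence `{x'ₙ}` in `F'`. -/
def LimitedSeq (x : ℕ → F) : Prop :=
  ∀ x' : ℕ → F →L[ℝ] ℝ, WeakStarNull x' →
    Tendsto (fun n => x' n (x n)) atTop (𝓝 0)

theorem bddAbove_range_abs_clm {E : Type*} [NormedAddCommGroup E] [NormedSpace ℝ E]
    {W : Set E} (hW : IsBounded W) (f : E →L[ℝ] ℝ) :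
    BddAbove (range fun a : W => |f a|) := by
  obtain ⟨C, hC⟩ := hW.exists_norm_le
  refine ⟨‖f‖ * C, ?_⟩
  rintro _ ⟨a, rfl⟩
  exact f.le_opNorm_of_le (hC a a.2)

/-- A bounded subset `W` of a Banach space `F` is limited if and only if
every sequence in `W` has a limited subsequence. -/
theorem limitedSet_iff_subseq (W : Set F) (hW : IsBounded W) :
    LimitedSet W ↔
      ∀ x : ℕ → F, (∀ n, x n ∈ W) →
        ∃ φ : ℕ → ℕ, StrictMono φ ∧ LimitedSeq (x ∘ φ) := by
  constructor
  · intro h x hx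
    refine ⟨id, strictMono_id, fun x' hx' => ?_⟩
    exact squeeze_zero_norm
      (fun n => le_ciSup (bddAbove_range_abs_clm hW (x' n)) ⟨x n, hx n⟩) (h x' hx')
  · intro h y' hy'
    rcases W.eq_empty_or_nonempty with rfl | hne
    · simp
    have : Nonempty W := hne.to_subtype
    have near : ∀ n, ∃ a : W, (⨆ a : W, |y' n a|) - 1 / ((n : ℝ) + 1) < |y' n a| := fun n =>
      exists_lt_of_lt_ciSup (sub_lt_self _ Nat.one_div_pos_of_nat)
    choose a ha using near
    refine tendsto_of_subseq_tendsto fun ns hns => ?_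
    obtain ⟨φ, hφ, hlim⟩ := h (fun k => (a (ns k) : F)) fun k => (a (ns k)).2
    have hsub : Tendsto (fun k => ns (φ k)) atTop atTop := hns.comp hφ.tendsto_atTop
    have h₁ := (hlim (fun k => y' (ns (φ k))) fun x => (hy' x).comp hsub).abs
    have h₂ := (tendsto_one_div_add_atTop_nhds_zero_nat (𝕜 := ℝ)).comp hsub
    have h₃ := h₁.add h₂
    rw [abs_zero, add_zero] at h₃
    refine ⟨φ, squeeze_zero (fun k => Real.iSup_nonneg fun _ => abs_nonneg _) (fun k => ?_) h₃⟩
    exact (sub_lt_iff_lt_add.mp (ha (ns (φ k)))).le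
end

section
/- Let 𝔄 be a surjective, idempotent operator ideal on Banach spaces and let 𝔅 be an operator ideal with 𝔄 ⊆ 𝔅. Then 𝔄 = 𝔆∘𝔅^sur, where 𝔆 = 𝔄∘(𝔅^sur)^{-1}; that is, T ∈ 𝔄(E,F) if and only if T = R∘S for some Banach space G, S ∈ 𝔅^sur(E,G) and R ∈ L(G,F) satisfying R∘S' ∈ 𝔄 for every Banach space H and every S' ∈ 𝔅^sur(H,G). -/
open Filter Topology Bornology Metric Set Pointwise

/-- Let `𝔄` be a surjective, idempotent operator ideal and `𝔅` an
operator ideal with `𝔄 ⊆ 𝔅`.  Then `𝔄 = 𝔆 ∘ 𝔅^sur` with `𝔆 = 𝔄 ∘ (𝔅^sur)⁻¹`: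
`T ∈ 𝔄(E,F)` iff `T = R ∘ S` for some Banach space `G`, `S ∈ 𝔅^sur(E,G)` and
`R ∈ L(G,F)` with `R ∘ S' ∈ 𝔄` for every Banach space `H` and every `S' ∈ 𝔅^sur(H,G)`. -/
theorem idempotent_factorization (A B : OperatorIdeal)
    (hAsur : A.Surjective)
    (hidem : ∀ (E F : Type) [BanachR E] [BanachR F] (T : E →L[ℝ] F),
      T ∈ A.carrier E F ↔
        ∃ (G : Type) (_ : BanachR G) (S : E →L[ℝ] G) (R : G →L[ℝ] F),
          S ∈ A.carrier E G ∧ R ∈ A.carrier G F ∧ T = R.comp S)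
    (hAB : ∀ (E F : Type) [BanachR E] [BanachR F], A.carrier E F ⊆ B.carrier E F)
    (E F : Type) [BanachR E] [BanachR F] (T : E →L[ℝ] F) :
    T ∈ A.carrier E F ↔
      ∃ (G : Type) (_ : BanachR G) (S : E →L[ℝ] G) (R : G →L[ℝ] F),
        S ∈ B.surHull E G ∧
        (∀ (H : Type) [BanachR H] (S' : H →L[ℝ] G),
          S' ∈ B.surHull H G → R.comp S' ∈ A.carrier H F) ∧
        T = R.comp S := by
  constructor
  · intro hT
    obtain ⟨G, _, S, R, hS, hR, rfl⟩ := (hidem E F T).1 hT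
    refine ⟨G, inferInstance, S, R, fun _ _ hB => hB _ _ (hAB _ _ hS), fun H _ S' _ => ?_, rfl⟩
    exact A.comp_mem _ _ _ _ (ContinuousLinearMap.id ℝ F) R S' hR
  · rintro ⟨G, _, S, R, hS, hR, rfl⟩
    exact hR E S hS
end

section
/- If W is a limited subset of a Banach space F, then its σ-disked hull Γ_σ W = {Σ_{n=1}^∞ λ_n w_n : Σ|λ_n| ≤ 1, w_n ∈ W, the series converging in norm} is again a limited subset of F; in particular, the limited bornology is σ-disked. -/
open Filter Topology Bornology Set

variable {F : Type*} [NormedAddCommGroup F] [NormedSpace ℝ F] [CompleteSpace F]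

/-- The `σ`-disked hull `Γ_σ W`: all sums `Σₙ λₙ wₙ` with `Σₙ |λₙ| ≤ 1`, `wₙ ∈ W`, the
series converging in norm. -/
def sigmaDiskedHull (W : Set F) : Set F :=
  {y | ∃ (lam : ℕ → ℝ) (w : ℕ → F), (∀ n, w n ∈ W) ∧ Summable (fun n => |lam n|) ∧
    (∑' n, |lam n|) ≤ 1 ∧
    Tendsto (fun N => ∑ n ∈ Finset.range N, lam n • w n) atTop (𝓝 y)}

omit [CompleteSpace F] in
/-- A functional bounded by `M` in absolute value on `W` is bounded by `M` on the `σ`-disked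
hull of `W`. -/
theorem abs_apply_le_of_mem_sigmaDiskedHull {W : Set F} {f : F →L[ℝ] ℝ} {M : ℝ}
    (hM : 0 ≤ M) (hf : ∀ a ∈ W, |f a| ≤ M) {y : F} (hy : y ∈ sigmaDiskedHull W) : |f y| ≤ M := by
  obtain ⟨lam, w, hw, hs, hle, hlim⟩ := hy
  refine le_of_tendsto ((f.continuous.tendsto y).comp hlim).abs (Eventually.of_forall fun N => ?_)
  calc |f (∑ n ∈ Finset.range N, lam n • w n)|
      = |∑ n ∈ Finset.range N, lam n * f (w n)| := by simp
    _ ≤ ∑ n ∈ Finset.range N, |lam n| * M := by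
        refine (Finset.abs_sum_le_sum_abs _ _).trans (Finset.sum_le_sum fun n _ => ?_)
        rw [abs_mul]
        exact mul_le_mul_of_nonneg_left (hf _ (hw n)) (abs_nonneg _)
    _ = (∑ n ∈ Finset.range N, |lam n|) * M := (Finset.sum_mul _ _ _).symm
    _ ≤ 1 * M := by
        gcongr
        exact (hs.sum_le_tsum _ fun n _ => abs_nonneg _).trans hle
    _ = M := one_mul M

/-- If `W` is a limited subset of a Banach space `F`, then its `σ`-disked
hull `Γ_σ W` is again limited; in particular, the limited bornology is `σ`-disked. -/
theorem limitedSet_sigmaDiskedHull (W : Set F) (hW : IsBounded W) (hlim : LimitedSet W) :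
    LimitedSet (sigmaDiskedHull W) := by
  intro y' hy'
  refine squeeze_zero (fun n => Real.iSup_nonneg fun _ => abs_nonneg _) (fun n => ?_) (hlim y' hy')
  have hM : 0 ≤ ⨆ a : W, |y' n a| := Real.iSup_nonneg fun _ => abs_nonneg _
  have hbdd : BddAbove (range fun a : W => |y' n a|) := by
    obtain ⟨C, hC⟩ := hW.exists_norm_le
    refine ⟨‖y' n‖ * C, ?_⟩
    rintro _ ⟨a, rfl⟩
    exact (y' n).le_opNorm_of_le (hC a a.2)
  exact Real.iSup_le (fun y => abs_apply_le_of_mem_sigmaDiskedHull hM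
    (fun a ha => le_ciSup hbdd ⟨a, ha⟩) y.2) hM
end

section
/- A continuous linear operator T : E → F between Banach spaces is compact if and only if there exist a Banach space G, a weakly compact operator S : E → G and a completely continuous operator R : G → F with T = R∘S. (In ideal notation: 𝔎 = 𝔙∘𝔚.) -/
open Filter Topology Bornology Metric Set

section Defs

variable {E F : Type} [BanachR E] [BanachR F]

/-- `T` is compact: the image of the closed unit ball is totally bounded. -/
def CompactOp (T : E →L[ℝ] F) : Prop :=
  TotallyBounded (T '' closedBall 0 1)

/-- `T` is weakly compact: the image of the closed unit ball is relatively compact in the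
weak topology `σ(F,F')`. -/
def WeaklyCompactOp (T : E →L[ℝ] F) : Prop :=
  IsCompact (closure (toWeakSpace ℝ F '' (T '' closedBall 0 1)))

/-- A sequence converges weakly to `x₀` if `f xₙ → f x₀` for every `f ∈ E'`. -/
def WeaklyConvergent (x : ℕ → E) (x₀ : E) : Prop :=
  ∀ f : E →L[ℝ] ℝ, Tendsto (fun n => f (x n)) atTop (𝓝 (f x₀))

/-- `T` is completely continuous: it maps weakly convergent sequences to norm-convergent
sequences. -/
def CompletelyContinuousOp (T : E →L[ℝ] F) : Prop :=
  ∀ (x : ℕ → E) (x₀ : E), WeaklyConvergent x x₀ →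
    ∃ y : F, Tendsto (fun n => T (x n)) atTop (𝓝 y)

/-- A Banach–Saks sequence: its Cesàro means converge in norm. -/
def BanachSaksSeq (x : ℕ → F) : Prop :=
  ∃ x₀ : F, Tendsto (fun n : ℕ => (n : ℝ)⁻¹ • ∑ i ∈ Finset.range n, x i) atTop (𝓝 x₀)

/-- `T` is a Banach–Saks operator: every bounded sequence has a subsequence whose image
under `T` is a Banach–Saks sequence. -/
def BanachSaksOp (T : E →L[ℝ] F) : Prop :=
  ∀ x : ℕ → E, IsBounded (range x) →
    ∃ φ : ℕ → ℕ, StrictMono φ ∧ BanachSaksSeq (fun k => T (x (φ k)))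

/-- `T` is weakly Banach–Saks: it sends each weakly convergent sequence to a sequence
possessing a Banach–Saks subsequence. -/
def WeaklyBanachSaksOp (T : E →L[ℝ] F) : Prop :=
  ∀ (x : ℕ → E) (x₀ : E), WeaklyConvergent x x₀ →
    ∃ φ : ℕ → ℕ, StrictMono φ ∧ BanachSaksSeq (fun k => T (x (φ k)))

/-- A weakly Cauchy sequence: `⟨xₙ, f⟩` converges for every `f ∈ E'`. -/
def WeaklyCauchy (x : ℕ → E) : Prop :=
  ∀ f : E →L[ℝ] ℝ, ∃ c : ℝ, Tendsto (fun n => f (x n)) atTop (𝓝 c)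

/-- `T` is Rosenthal compact: every bounded sequence has a subsequence whose image under
`T` is weakly Cauchy. -/
def RosenthalCompactOp (T : E →L[ℝ] F) : Prop :=
  ∀ x : ℕ → E, IsBounded (range x) →
    ∃ φ : ℕ → ℕ, StrictMono φ ∧ WeaklyCauchy (fun k => T (x (φ k)))

/-- `T` is a weakly sequentially complete operator: it sends each weakly Cauchy sequence
to a sequence having a weakly convergent subsequence. -/
def WeaklySeqCompleteOp (T : E →L[ℝ] F) : Prop :=
  ∀ x : ℕ → E, WeaklyCauchy x →
    ∃ φ : ℕ → ℕ, StrictMono φ ∧ ∃ y₀ : F, WeaklyConvergent (fun k => T (x (φ k))) y₀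

end Defs

section Auxiliary

lemma Metric.totallyBounded_of_forall_exists_dist_lt {X : Type*} [PseudoMetricSpace X] {s : Set X}
    (h : ∀ ε > 0, ∃ t, TotallyBounded t ∧ ∀ x ∈ s, ∃ y ∈ t, dist x y < ε) :
    TotallyBounded s := by
  rw [Metric.totallyBounded_iff]
  intro ε hε
  obtain ⟨t, ht, hst⟩ := h (ε / 2) (half_pos hε)
  obtain ⟨c, hc, htc⟩ := Metric.totallyBounded_iff.1 ht (ε / 2) (half_pos hε)
  refine ⟨c, hc, fun x hx => ?_⟩
  obtain ⟨y, hy, hxy⟩ := hst x hx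
  obtain ⟨z, hz, hyz⟩ := mem_iUnion₂.1 (htc hy)
  refine mem_iUnion₂.2 ⟨z, hz, ?_⟩
  have := dist_triangle x y z
  rw [mem_ball] at hyz ⊢
  linarith

lemma totallyBounded_of_forall_exists_cauchySeq_subseq {X : Type*} [UniformSpace X] {s : Set X}
    (h : ∀ u : ℕ → X, (∀ n, u n ∈ s) → ∃ φ : ℕ → ℕ, StrictMono φ ∧ CauchySeq (u ∘ φ)) :
    TotallyBounded s := by
  intro V hV
  contrapose! h
  obtain ⟨u, u_in, hu⟩ : ∃ u : ℕ → X, (∀ n, u n ∈ s) ∧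
      ∀ n m, m < n → u m ∉ UniformSpace.ball (u n) V := by
    simp only [not_subset, mem_iUnion₂, not_exists, exists_prop] at h
    simpa only [forall_and, forall_mem_image, not_and] using! seq_of_forall_finite_exists h
  refine ⟨u, u_in, fun φ hφ huφ => ?_⟩
  obtain ⟨N, hN⟩ : ∃ N, ∀ p q, p ≥ N → q ≥ N → (u (φ p), u (φ q)) ∈ V :=
    huφ.mem_entourage hV
  exact hu (φ <| N + 1) (φ N) (hφ <| Nat.lt_add_one N) (hN (N + 1) N N.le_succ le_rfl)

section Normed

variable {G F : Type*} [NormedAddCommGroup G] [NormedSpace ℝ G]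
  [NormedAddCommGroup F] [NormedSpace ℝ F]

lemma WeakSpace.continuous_eval (f : G →L[ℝ] ℝ) :
    Continuous fun x : WeakSpace ℝ G => f ((toWeakSpace ℝ G).symm x) :=
  WeakBilin.eval_continuous (topDualPairing ℝ G).flip f

/-- On a separable set, countably many functionals detect vanishing of vectors. -/
lemma exists_countable_dual_separating {M : Set G} (hM : TopologicalSpace.IsSeparable M) :
    ∃ (D : Set G) (f : G → G →L[ℝ] ℝ), D.Countable ∧
      ∀ z ∈ M, (∀ d ∈ D, f d z = 0) → z = 0 := by
  obtain ⟨D, hD, hMD⟩ := hM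
  choose f hf₁ hf₂ using fun x : G => exists_dual_vector'' ℝ x
  refine ⟨D, f, hD, fun z hz h => ?_⟩
  refine norm_le_zero_iff.1 (le_of_forall_pos_le_add fun ε hε => ?_)
  obtain ⟨d, hd, hzd⟩ := Metric.mem_closure_iff.1 (hMD hz) (ε / 2) (half_pos hε)
  rw [dist_eq_norm] at hzd
  have h₁ : ‖d‖ ≤ ‖z - d‖ := by
    have h₂ : f d (d - z) = ‖d‖ := by
      rw [map_sub, h d hd, sub_zero]
      exact hf₂ d
    calc ‖d‖ = f d (d - z) := h₂.symm
      _ ≤ ‖f d (d - z)‖ := Real.le_norm_self _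
      _ ≤ 1 * ‖d - z‖ := (f d).le_of_opNorm_le (hf₁ d) _
      _ = ‖z - d‖ := by rw [one_mul, norm_sub_rev]
  have h₃ : ‖z‖ ≤ ‖z - d‖ + ‖d‖ := by simpa using norm_add_le (z - d) d
  linarith

/-- The implication of the Eberlein–Šmulian theorem from weak compactness to weak sequential
compactness. -/
lemma exists_subseq_tendsto_of_isCompact_weakSpace {C : Set (WeakSpace ℝ G)} (hC : IsCompact C)
    {u : ℕ → G} (hu : ∀ n, toWeakSpace ℝ G (u n) ∈ C) :
    ∃ (φ : ℕ → ℕ) (x₀ : G), StrictMono φ ∧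
      ∀ f : G →L[ℝ] ℝ, Tendsto (fun n => f (u (φ n))) atTop (𝓝 (f x₀)) := by
  set M : Submodule ℝ G := Submodule.span ℝ (range u)
  have hMsep : TopologicalSpace.IsSeparable (closure (M : Set G)) :=
    ((countable_range u).isSeparable.span (R := ℝ)).closure
  obtain ⟨D, f, hD, hsep⟩ := exists_countable_dual_separating hMsep
  have hK : IsCompact (C ∩ toWeakSpace ℝ G '' closure (M : Set G)) := by
    refine hC.inter_right ?_
    rw [M.convex.toWeakSpace_closure ℝ]
    exact isClosed_closure
  set K := C ∩ toWeakSpace ℝ G '' closure (M : Set G)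
  have : CompactSpace K := isCompact_iff_compactSpace.1 hK
  have : Countable D := hD
  let Φ : K → D → ℝ := fun x d => f d ((toWeakSpace ℝ G).symm x)
  have hΦ : Continuous Φ :=
    continuous_pi fun d => (WeakSpace.continuous_eval (f d)).comp continuous_subtype_val
  have hΦinj : Function.Injective Φ := by
    rintro ⟨_, hxC, x, hx, rfl⟩ ⟨_, hyC, y, hy, rfl⟩ hxy
    have hz : x - y ∈ closure (M : Set G) := M.topologicalClosure.sub_mem hx hy
    have h0 : x - y = 0 := by
      refine hsep _ hz fun d hd => ?_
      have := congrFun hxy ⟨d, hd⟩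
      simp only [Φ, LinearEquiv.symm_apply_apply] at this
      rw [map_sub, this, sub_self]
    simp [sub_eq_zero.1 h0]
  have : FirstCountableTopology K :=
    (hΦ.isClosedEmbedding hΦinj).isInducing.firstCountableTopology
  obtain ⟨a, φ, hφ, ha⟩ := CompactSpace.tendsto_subseq (X := K) fun n =>
    ⟨toWeakSpace ℝ G (u n), hu n, u n,
      subset_closure (Submodule.subset_span (mem_range_self n)), rfl⟩
  refine ⟨φ, (toWeakSpace ℝ G).symm a, hφ, fun g => ?_⟩
  exact (((WeakSpace.continuous_eval g).comp continuous_subtype_val).tendsto a).comp ha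

lemma exists_norm_le_of_forall_dual_tendsto {x : ℕ → G} {x₀ : G}
    (hx : ∀ f : G →L[ℝ] ℝ, Tendsto (fun n => f (x n)) atTop (𝓝 (f x₀))) :
    ∃ C, ∀ n, ‖x n‖ ≤ C := by
  obtain ⟨C, hC⟩ := banach_steinhaus (g := fun n => NormedSpace.inclusionInDoubleDual ℝ G (x n))
    fun f => by
      obtain ⟨C, hC⟩ := (Metric.isBounded_range_of_tendsto _ (hx f)).exists_norm_le
      exact ⟨C, fun n => hC _ (mem_range_self n)⟩
  refine ⟨C, fun n => ?_⟩
  exact ((NormedSpace.inclusionInDoubleDualLi ℝ).norm_map (x n)).symm.trans_le (hC n)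

lemma TotallyBounded.image_closedBall_of_image_closedBall_one {T : G →L[ℝ] F}
    (hT : TotallyBounded (T '' closedBall 0 1)) (r : ℝ) :
    TotallyBounded (T '' closedBall 0 r) := by
  have h := hT.image (uniformContinuous_const_smul (M := ℝ) (X := F) (max r 1))
  refine h.subset ?_
  have hr : 0 < max r 1 := lt_max_of_lt_right one_pos
  rintro _ ⟨x, hx, rfl⟩
  refine ⟨T ((max r 1)⁻¹ • x), mem_image_of_mem _ ?_, ?_⟩
  · rw [mem_closedBall_zero_iff] at hx ⊢
    rw [norm_smul, norm_inv, Real.norm_of_nonneg hr.le, inv_mul_le_one₀ hr]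
    exact hx.trans (le_max_left _ _)
  · simp only [map_smul]
    rw [smul_inv_smul₀ hr.ne']

lemma totallyBounded_image_norm_mul_norm_le_one {T : G →L[ℝ] F}
    (hT : TotallyBounded (T '' closedBall 0 1)) :
    TotallyBounded (T '' {x | ‖x‖ * ‖T x‖ ≤ 1}) := by
  refine Metric.totallyBounded_of_forall_exists_dist_lt fun ε hε =>
    ⟨_, hT.image_closedBall_of_image_closedBall_one (2 / ε), ?_⟩
  rintro _ ⟨x, hx, rfl⟩
  by_cases hxε : ‖x‖ ≤ 2 / ε
  · exact ⟨T x, mem_image_of_mem _ (by simpa using hxε), by simpa using hε⟩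
  · refine ⟨T 0, mem_image_of_mem _ (by simp; positivity), ?_⟩
    rw [map_zero, dist_zero_right]
    by_contra! h
    have h2 : 2 / ε * ε ≤ ‖x‖ * ‖T x‖ :=
      mul_le_mul (not_le.1 hxε).le h hε.le (norm_nonneg _)
    rw [div_mul_cancel₀ _ hε.ne'] at h2
    have : ‖x‖ * ‖T x‖ ≤ 1 := hx
    linarith

/-- A seminorm lying between the norm of the domain and the seminorm induced by a compact
operator, compactly in both directions. -/
lemma exists_seminorm_of_totallyBounded_image_closedBall {T : G →L[ℝ] F}
    (hT : TotallyBounded (T '' closedBall 0 1)) :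
    ∃ p : Seminorm ℝ G, (∃ C, ∀ x, p x ≤ C * ‖x‖) ∧
      (∀ ε > 0, ∃ δ > 0, ∀ x, ‖x‖ ≤ 2 → ‖T x‖ ≤ δ → p x ≤ ε) ∧
      TotallyBounded (T '' {x | p x < 1}) := by
  set A : Set G := {x | ‖x‖ * ‖T x‖ ≤ 1} with hA
  have hbal : Balanced ℝ (convexHull ℝ A) := by
    refine Balanced.convexHull ?_
    rw [balanced_iff_smul_mem]
    intro a ha x hx
    have hx' : ‖x‖ * ‖T x‖ ≤ 1 := hx
    change ‖a • x‖ * ‖T (a • x)‖ ≤ 1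
    rw [map_smul, norm_smul, norm_smul]
    have h0 : 0 ≤ ‖x‖ * ‖T x‖ := by positivity
    have ha2 : ‖a‖ * ‖a‖ ≤ 1 := mul_le_one₀ ha (norm_nonneg _) ha
    calc ‖a‖ * ‖x‖ * (‖a‖ * ‖T x‖) = (‖a‖ * ‖a‖) * (‖x‖ * ‖T x‖) := by ring
      _ ≤ 1 := mul_le_one₀ ha2 h0 hx'
  have hnhds : convexHull ℝ A ∈ 𝓝 (0 : G) := by
    have hc : Continuous fun x : G => ‖x‖ * ‖T x‖ := by fun_prop
    have : ∀ᶠ x in 𝓝 (0 : G), ‖x‖ * ‖T x‖ < 1 :=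
      hc.continuousAt.eventually_lt continuousAt_const (by simp)
    exact mem_of_superset this fun x (hx : ‖x‖ * ‖T x‖ < 1) => subset_convexHull ℝ A hx.le
  have habs : Absorbent ℝ (convexHull ℝ A) := absorbent_nhds_zero hnhds
  have hle : ∀ r > 0, ∀ x, ‖x‖ * ‖T x‖ ≤ r * r → gauge (convexHull ℝ A) x ≤ r := by
    intro r hr x hx
    refine gauge_le_of_mem hr.le ((mem_smul_set_iff_inv_smul_mem₀ hr.ne' _ _).2 ?_)
    refine subset_convexHull ℝ A ?_
    change ‖r⁻¹ • x‖ * ‖T (r⁻¹ • x)‖ ≤ 1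
    rw [map_smul, norm_smul, norm_smul, norm_inv, Real.norm_of_nonneg hr.le]
    calc r⁻¹ * ‖x‖ * (r⁻¹ * ‖T x‖) = (r * r)⁻¹ * (‖x‖ * ‖T x‖) := by
          rw [mul_inv]; ring
      _ ≤ 1 := (inv_mul_le_one₀ (by positivity)).2 hx
  refine ⟨gaugeSeminorm hbal (convex_convexHull ℝ A) habs, ?_, ?_, ?_⟩
  · obtain ⟨r, hr, hrA⟩ := Metric.mem_nhds_iff.1 hnhds
    refine ⟨r⁻¹, fun x => ?_⟩
    have := mul_gauge_le_norm (x := x) hrA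
    rw [gaugeSeminorm_toFun]
    rwa [le_inv_mul_iff₀ hr]
  · intro ε hε
    refine ⟨ε * ε / 2, by positivity, fun x hx hTx => ?_⟩
    refine hle ε hε x ?_
    calc ‖x‖ * ‖T x‖ ≤ 2 * (ε * ε / 2) := by gcongr
      _ = ε * ε := by ring
  · have h := (totallyBounded_image_norm_mul_norm_le_one hT).convexHull
    refine h.subset ?_
    refine Subset.trans (image_mono ?_) (T.toLinearMap.isLinear.image_convexHull A).subset
    exact setOfPred_gauge_lt_one_subset_self (convex_convexHull ℝ A)
      (subset_convexHull ℝ A (by simp [hA])) habs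

end Normed

/-- The Hausdorff completion of a vector space with respect to a seminorm. -/
lemma exists_banachR_completion {V : Type} [AddCommGroup V] [Module ℝ V] (p : Seminorm ℝ V) :
    ∃ (G : Type) (_ : BanachR G) (e : V →ₗ[ℝ] G), DenseRange e ∧ ∀ x, ‖e x‖ = p x := by
  let : SeminormedAddCommGroup V := p.toAddGroupSeminorm.toSeminormedAddCommGroup
  let : NormedSpace ℝ V := ⟨fun a x => (map_smul_eq_mul p a x).le⟩
  refine ⟨UniformSpace.Completion V, {}, UniformSpace.Completion.toComplₗᵢ.toLinearMap,
    UniformSpace.Completion.denseRange_coe, fun x => ?_⟩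
  exact UniformSpace.Completion.norm_coe x

variable {E F : Type} [BanachR E] [BanachR F]

lemma CompactOp.weaklyCompactOp {T : E →L[ℝ] F} (hT : CompactOp T) : WeaklyCompactOp T := by
  have hK : IsCompact (closure (T '' closedBall 0 1)) :=
    (TotallyBounded.closure hT).isCompact_of_isClosed isClosed_closure
  have hK' := hK.image (toWeakSpaceCLM ℝ F).continuous
  exact hK'.closure_of_subset (image_mono subset_closure)

lemma CompactOp.completelyContinuousOp {T : E →L[ℝ] F} (hT : CompactOp T) :
    CompletelyContinuousOp T := by
  intro x x₀ hx
  obtain ⟨C, hC⟩ := exists_norm_le_of_forall_dual_tendsto hx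
  have hK : IsCompact (closure (T '' closedBall 0 C)) :=
    (TotallyBounded.image_closedBall_of_image_closedBall_one hT C).closure.isCompact_of_isClosed
      isClosed_closure
  refine ⟨T x₀, hK.tendsto_nhds_of_unique_mapClusterPt
    (Eventually.of_forall fun n => subset_closure (mem_image_of_mem _ (by simpa using hC n)))
    fun y _ hy => ?_⟩
  refine (SeparatingDual.eq_iff_forall_dual_eq (R := ℝ)).2 fun f => ?_
  have hfy : MapClusterPt (f y) atTop (fun n => f (T (x n))) :=
    hy.continuousAt_comp f.continuous.continuousAt
  exact eq_of_nhds_neBot (NeBot.mono hfy (inf_le_inf_left _ (hx (f.comp T))))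

lemma CompletelyContinuousOp.compactOp_comp {G : Type} [BanachR G] {S : E →L[ℝ] G}
    {R : G →L[ℝ] F} (hR : CompletelyContinuousOp R) (hS : WeaklyCompactOp S) :
    CompactOp (R.comp S) := by
  refine totallyBounded_of_forall_exists_cauchySeq_subseq fun u hu => ?_
  choose x hx hxu using hu
  obtain ⟨φ, y₀, hφ, hy⟩ := exists_subseq_tendsto_of_isCompact_weakSpace hS
    (u := fun n => S (x n)) fun n =>
      subset_closure (mem_image_of_mem _ (mem_image_of_mem _ (hx n)))
  obtain ⟨z, hz⟩ := hR _ y₀ hy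
  refine ⟨φ, hφ, ?_⟩
  have : u ∘ φ = fun n => R (S (x (φ n))) := funext fun n => (hxu (φ n)).symm
  rw [this]
  exact hz.cauchySeq

/-- Every compact operator between Banach spaces is a product of two compact operators. -/
lemma CompactOp.exists_eq_comp {T : E →L[ℝ] F} (hT : CompactOp T) :
    ∃ (G : Type) (_ : BanachR G) (S : E →L[ℝ] G) (R : G →L[ℝ] F),
      CompactOp S ∧ CompactOp R ∧ T = R.comp S := by
  obtain ⟨p, ⟨C, hC⟩, hpS, hpR⟩ := exists_seminorm_of_totallyBounded_image_closedBall hT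
  obtain ⟨G, instG, e, he, hep⟩ := exists_banachR_completion p
  have hbound : ∃ M : ℝ, ∀ x, ‖T.toLinearMap x‖ ≤ M * ‖e x‖ := by
    obtain ⟨M, hM0, hM⟩ := hpR.isBounded.exists_pos_norm_le
    refine ⟨M, fun x => ?_⟩
    rw [hep, ← div_le_iff₀' hM0]
    refine le_of_forall_gt_imp_ge_of_dense fun b hb => ?_
    have hb0 : 0 < b := (apply_nonneg p x).trans_lt hb
    have hx : p (b⁻¹ • x) < 1 := by
      rw [map_smul_eq_mul, norm_inv, Real.norm_of_nonneg hb0.le]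
      exact (inv_mul_lt_one₀ hb0).2 hb
    have hTx := hM _ (mem_image_of_mem T hx)
    rw [map_smul, norm_smul, norm_inv, Real.norm_of_nonneg hb0.le, inv_mul_le_iff₀ hb0] at hTx
    exact (div_le_iff₀ hM0).2 hTx
  let S : E →L[ℝ] G := e.mkContinuous C fun x => (hep x).trans_le (hC x)
  let R : G →L[ℝ] F := T.toLinearMap.extendOfNorm e
  have hRe : ∀ x, R (e x) = T x := LinearMap.extendOfNorm_eq he hbound
  refine ⟨G, instG, S, R, ?_, ?_, ?_⟩
  · refine Metric.totallyBounded_iff.2 fun ε hε => ?_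
    obtain ⟨δ, hδ, hpδ⟩ := hpS (ε / 2) (half_pos hε)
    obtain ⟨t, hts, ht, hcov⟩ := exists_subset_image_finite_and.1
      (Metric.finite_approx_of_totallyBounded hT δ hδ)
    refine ⟨S '' t, ht.image S, ?_⟩
    rintro _ ⟨x, hx, rfl⟩
    obtain ⟨_, ⟨z, hz, rfl⟩, hxz⟩ := mem_iUnion₂.1 (hcov (mem_image_of_mem T hx))
    refine mem_iUnion₂.2 ⟨S z, mem_image_of_mem S hz, ?_⟩
    rw [mem_ball, dist_eq_norm, ← map_sub] at hxz ⊢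
    have hz1 := hts hz
    rw [mem_closedBall_zero_iff] at hx hz1
    have h2 : ‖x - z‖ ≤ 2 := by linarith [norm_sub_le x z]
    have h3 : ‖S (x - z)‖ ≤ ε / 2 := (hep _).trans_le (hpδ _ h2 hxz.le)
    linarith
  · refine (totallyBounded_closure.2 hpR).subset ?_
    have h1 : closedBall (0 : G) 1 ⊆ closure (ball 0 1 ∩ range e) := by
      rw [← closure_ball (0 : G) one_ne_zero]
      exact closure_minimal (he.open_subset_closure_inter isOpen_ball) isClosed_closure
    refine (image_mono h1).trans ((image_closure_subset_closure_image R.continuous).trans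
      (closure_mono ?_))
    rintro _ ⟨_, ⟨hx, x, rfl⟩, rfl⟩
    rw [mem_ball_zero_iff, hep] at hx
    exact ⟨x, hx, (hRe x).symm⟩
  · ext x
    exact (hRe x).symm

end Auxiliary

/-- A continuous linear operator `T : E → F` between Banach spaces is
compact iff it factors as `T = R ∘ S` with `S` weakly compact and `R` completely
continuous through some Banach space `G`.  (`𝔎 = 𝔙 ∘ 𝔚`.) -/
theorem compact_iff_completelyContinuous_comp_weaklyCompact
    (E F : Type) [BanachR E] [BanachR F] (T : E →L[ℝ] F) :
    CompactOp T ↔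
      ∃ (G : Type) (_ : BanachR G) (S : E →L[ℝ] G) (R : G →L[ℝ] F),
        WeaklyCompactOp S ∧ CompletelyContinuousOp R ∧ T = R.comp S := by
  constructor
  · intro hT
    obtain ⟨G, instG, S, R, hS, hR, h⟩ := hT.exists_eq_comp
    exact ⟨G, instG, S, R, hS.weaklyCompactOp, hR.completelyContinuousOp, h⟩
  · rintro ⟨G, instG, S, R, hS, hR, rfl⟩
    exact hR.compactOp_comp hS
end

section
/- A continuous linear operator T : E → F between Banach spaces is weakly Banach–Saks if and only if for every Banach space G and every weakly compact operator S : G → E, the composition T∘S : G → F is a Banach–Saks operator. (In ideal notation: w𝔅𝔖 = 𝔅𝔖∘𝔚^{-1}.) -/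
open Filter Topology Bornology Metric Set

/-- In a weakly compact set, every sequence has a weakly convergent subsequence: the easy half of
the Eberlein–Šmulian theorem. -/
theorem exists_weaklyConvergent_subseq {E : Type} [BanachR E] {K : Set (WeakSpace ℝ E)}
    (hK : IsCompact K) (y : ℕ → E) (hy : ∀ n, toWeakSpace ℝ E (y n) ∈ K) :
    ∃ φ : ℕ → ℕ, StrictMono φ ∧ ∃ x₀ : E, WeaklyConvergent (fun k => y (φ k)) x₀ := by
  set Y : Submodule ℝ E := (Submodule.span ℝ (range y)).topologicalClosure with hY
  have hyY : ∀ n, y n ∈ Y := fun n =>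
    Submodule.le_topologicalClosure _ (Submodule.subset_span (mem_range_self n))
  have hsep : TopologicalSpace.IsSeparable (Y : Set E) := by
    rw [hY, Submodule.topologicalClosure_coe]
    exact (TopologicalSpace.IsSeparable.span (countable_range y).isSeparable).closure
  have hYclosed : IsClosed (toWeakSpace ℝ E '' (Y : Set E)) := by
    have h := Convex.toWeakSpace_closure ℝ Y.convex
    rw [(Submodule.isClosed_topologicalClosure _ : IsClosed (Y : Set E)).closure_eq] at h
    exact h ▸ isClosed_closure
  obtain ⟨c, hc, hYc⟩ := hsep
  have : Nonempty c := by
    by_contra h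
    rw [not_nonempty_iff, isEmpty_coe_sort] at h
    simpa [h] using hYc (hyY 0)
  have := hc.to_subtype
  obtain ⟨u, hu⟩ := exists_surjective_nat c
  choose g hg hgu using fun n => exists_dual_vector'' ℝ (u n : E)
  set L : Set (WeakSpace ℝ E) := K ∩ toWeakSpace ℝ E '' (Y : Set E)
  have hL : IsCompact L := hK.inter_right hYclosed
  have : CompactSpace L := isCompact_iff_compactSpace.mp hL
  have heval : ∀ f : E →L[ℝ] ℝ, Continuous fun x : WeakSpace ℝ E => f ((toWeakSpace ℝ E).symm x) :=
    fun f => WeakBilin.eval_continuous (topDualPairing ℝ E).flip f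
  have : TopologicalSpace.MetrizableSpace L := by
    refine Metric.PiNatEmbed.TopologicalSpace.MetrizableSpace.of_countable_separating
      (fun n (x : L) => g n ((toWeakSpace ℝ E).symm x))
      (fun n => (heval (g n)).comp continuous_subtype_val) ?_
    rintro ⟨_, _, a, ha, rfl⟩ ⟨_, _, b, hb, rfl⟩ hab
    have hne : 0 < ‖a - b‖ := by
      rw [norm_pos_iff, sub_ne_zero]
      exact fun h => hab (Subtype.ext (congrArg (toWeakSpace ℝ E) h))
    obtain ⟨v, hv, hvd⟩ := Metric.mem_closure_iff.mp (hYc (Y.sub_mem ha hb)) (‖a - b‖ / 2)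
      (half_pos hne)
    obtain ⟨n, hn⟩ := hu ⟨v, hv⟩
    refine ⟨n, fun heq => ?_⟩
    have hgz : g n (a - b) = 0 := by
      rw [map_sub, sub_eq_zero]
      exact heq
    have hgv : g n v = ‖v‖ := by simpa [hn] using hgu n
    have h1 : |g n (a - b - v)| ≤ ‖a - b - v‖ := by
      simpa using (g n).le_of_opNorm_le (hg n) (a - b - v)
    rw [map_sub, hgz, hgv, zero_sub, abs_neg, abs_norm] at h1
    rw [dist_eq_norm] at hvd
    have h2 : ‖a - b‖ ≤ ‖a - b - v‖ + ‖v‖ := by simpa using norm_add_le (a - b - v) v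
    linarith
  obtain ⟨a, φ, hφ, ha⟩ := CompactSpace.tendsto_subseq
    (fun n => (⟨toWeakSpace ℝ E (y n), hy n, y n, hyY n, rfl⟩ : L))
  refine ⟨φ, hφ, (toWeakSpace ℝ E).symm a, fun f => ?_⟩
  exact (((heval f).comp continuous_subtype_val).tendsto a).comp ha

/-- A weakly convergent sequence is bounded in norm. -/
theorem WeaklyConvergent.exists_norm_le {E : Type} [BanachR E] {x : ℕ → E} {x₀ : E}
    (hx : WeaklyConvergent x x₀) : ∃ C, ∀ n, ‖x n‖ ≤ C := by
  obtain ⟨C, hC⟩ := banach_steinhaus (g := fun n => NormedSpace.inclusionInDoubleDual ℝ E (x n))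
    fun f => by
      obtain ⟨C, hC⟩ := (hx f).norm.bddAbove_range
      exact ⟨C, fun n => hC (mem_range_self n)⟩
  refine ⟨C, fun n => ?_⟩
  rw [← (NormedSpace.inclusionInDoubleDualLi (𝕜 := ℝ) (E := E)).norm_map (x n)]
  exact hC n

/-- The space `ℓ¹` of absolutely summable real sequences is a Banach space. -/
noncomputable instance : BanachR (lp (fun _ : ℕ => ℝ) 1) where

/-- The unit ball of `ℓ¹`, as a subset of the product space `ℕ → ℝ`. -/
def l1Ball : Set (ℕ → ℝ) := {a | ∀ s : Finset ℕ, ∑ i ∈ s, |a i| ≤ 1}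

theorem isCompact_l1Ball : IsCompact l1Ball := by
  refine (isCompact_univ_pi fun _ : ℕ => isCompact_Icc (a := (-1 : ℝ)) (b := 1)).of_isClosed_subset
    ?_ fun a ha i _ => ?_
  · simp only [l1Ball, Set.ofPred_forall]
    exact isClosed_iInter fun s => isClosed_le (by fun_prop) continuous_const
  · exact abs_le.mp (by simpa using ha {i})

theorem summable_abs_of_mem_l1Ball {a : ℕ → ℝ} (ha : a ∈ l1Ball) : Summable fun n => |a n| :=
  summable_of_sum_le (fun _ => abs_nonneg _) ha

theorem continuousOn_tsum_mul_l1Ball {c : ℕ → ℝ} (hc : Tendsto c atTop (𝓝 0)) :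
    ContinuousOn (fun a : ℕ → ℝ => ∑' n, a n * c n) l1Ball := by
  have hunif : TendstoUniformlyOn (fun N (a : ℕ → ℝ) => ∑ n ∈ Finset.range N, a n * c n)
      (fun a => ∑' n, a n * c n) atTop l1Ball := by
    rw [Metric.tendstoUniformlyOn_iff]
    intro ε hε
    obtain ⟨N₀, hN₀⟩ := Metric.tendsto_atTop.mp hc (ε / 2) (half_pos hε)
    filter_upwards [eventually_ge_atTop N₀] with N hN a ha
    have hbound : ∀ n, ‖a (n + N) * c (n + N)‖ ≤ |a (n + N)| * (ε / 2) := fun n => by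
      rw [norm_mul]
      have := hN₀ (n + N) (by omega)
      rw [dist_zero_right] at this
      exact mul_le_mul_of_nonneg_left this.le (abs_nonneg _)
    have hsum := summable_abs_of_mem_l1Ball ha
    have htail : Summable fun n => |a (n + N)| * (ε / 2) :=
      ((summable_nat_add_iff N).mpr hsum).mul_right _
    have hac : Summable fun n => a n * c n :=
      (summable_nat_add_iff N).mp (htail.of_norm_bounded hbound)
    rw [← hac.sum_add_tsum_nat_add N, dist_eq_norm, add_sub_cancel_left]
    refine (tsum_of_norm_bounded htail.hasSum hbound).trans_lt ?_
    rw [tsum_mul_right]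
    have h1 : ∑' n, |a (n + N)| ≤ 1 :=
      ((summable_nat_add_iff N).mpr hsum).tsum_le_of_sum_range_le fun m => by
        refine le_trans ?_ (ha ((Finset.range m).map (addRightEmbedding N)))
        simp
    nlinarith
  exact hunif.continuousOn (Frequently.of_forall fun N => by fun_prop)

theorem isBounded_range_l1_single :
    IsBounded (range fun n => (lp.single 1 n 1 : lp (fun _ : ℕ => ℝ) 1)) := by
  refine isBounded_iff_forall_norm_le.mpr ⟨1, ?_⟩
  rintro _ ⟨n, rfl⟩
  have h : ‖(lp.single 1 n 1 : lp (fun _ : ℕ => ℝ) 1)‖ = ‖(1 : ℝ)‖ :=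
    lp.norm_single (E := fun _ : ℕ => ℝ) (by simp) n 1
  exact (h.trans norm_one).le

/-- The operator `a ↦ ∑ aₙ yₙ` on `ℓ¹` attached to a bounded sequence `y`. -/
noncomputable def l1Lift {E : Type} [BanachR E] (y : ℕ → E) (C : ℝ) (hC : ∀ n, ‖y n‖ ≤ C) :
    lp (fun _ : ℕ => ℝ) 1 →L[ℝ] E :=
  have hs (a : lp (fun _ : ℕ => ℝ) 1) : HasSum (fun n => ‖a n‖) ‖a‖ := by
    simpa using lp.hasSum_norm (p := 1) (by simp) a
  have hb (a : lp (fun _ : ℕ => ℝ) 1) (n : ℕ) : ‖a n • y n‖ ≤ ‖a n‖ * C := by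
    rw [norm_smul]
    exact mul_le_mul_of_nonneg_left (hC n) (norm_nonneg _)
  have hsum (a : lp (fun _ : ℕ => ℝ) 1) : Summable fun n => a n • y n :=
    ((hs a).summable.mul_right C).of_norm_bounded (hb a)
  LinearMap.mkContinuous
    { toFun := fun a => ∑' n, a n • y n
      map_add' := fun a b => by
        rw [← (hsum a).tsum_add (hsum b)]
        simp [add_smul]
      map_smul' := fun r a => by
        rw [RingHom.id_apply, ← (hsum a).tsum_const_smul r]
        simp [mul_smul] } C fun a => by
    rw [mul_comm]
    exact tsum_of_norm_bounded ((hs a).mul_right C) (hb a)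

theorem l1Lift_apply {E : Type} [BanachR E] (y : ℕ → E) (C : ℝ) (hC : ∀ n, ‖y n‖ ≤ C)
    (a : lp (fun _ : ℕ => ℝ) 1) : l1Lift y C hC a = ∑' n, a n • y n := rfl

theorem l1Lift_single {E : Type} [BanachR E] (y : ℕ → E) (C : ℝ) (hC : ∀ n, ‖y n‖ ≤ C) (n : ℕ) :
    l1Lift y C hC (lp.single 1 n 1) = y n := by
  rw [l1Lift_apply, tsum_eq_single n fun m hm => by rw [lp.single_apply_ne _ _ _ hm, zero_smul],
    lp.single_apply_self, one_smul]

/-- The operator `ℓ¹ → E` attached to a weakly null sequence is weakly compact. -/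
theorem weaklyCompactOp_l1Lift {E : Type} [BanachR E] (y : ℕ → E) (C : ℝ) (hC : ∀ n, ‖y n‖ ≤ C)
    (hy : WeaklyConvergent y 0) : WeaklyCompactOp (l1Lift y C hC) := by
  have hcont : ContinuousOn (fun a : ℕ → ℝ => toWeakSpace ℝ E (∑' n, a n • y n)) l1Ball := by
    rw [continuousOn_iff_continuous_domRestrict]
    refine WeakBilin.continuous_of_continuous_eval (topDualPairing ℝ E).flip fun f => ?_
    have hf : Tendsto (fun n => f (y n)) atTop (𝓝 0) := by simpa using hy f
    refine (continuousOn_tsum_mul_l1Ball hf).domRestrict.congr fun a => ?_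
    have hsum : Summable fun n => (a : ℕ → ℝ) n • y n :=
      ((summable_abs_of_mem_l1Ball a.2).mul_right C).of_norm_bounded fun n => by
        rw [norm_smul]
        exact mul_le_mul_of_nonneg_left (hC n) (norm_nonneg _)
    change _ = f (∑' n, (a : ℕ → ℝ) n • y n)
    rw [f.map_tsum hsum]
    simp
  refine (isCompact_l1Ball.image_of_continuousOn hcont).closure_of_subset ?_
  rintro _ ⟨_, ⟨a, ha, rfl⟩, rfl⟩
  refine ⟨a, fun s => ?_, rfl⟩
  have h := lp.sum_rpow_le_norm_rpow (p := 1) (by simp) a s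
  simp only [ENNReal.toReal_one, Real.rpow_one] at h
  exact h.trans (mem_closedBall_zero_iff.mp ha)

/-- Translating a sequence by a constant preserves the Banach–Saks property. -/
theorem BanachSaksSeq.add_const {F : Type} [BanachR F] {x : ℕ → F} (hx : BanachSaksSeq x) (v : F) :
    BanachSaksSeq fun n => x n + v := by
  obtain ⟨x₀, hx₀⟩ := hx
  have hv : Tendsto (fun n : ℕ => (n : ℝ)⁻¹ • ∑ _i ∈ Finset.range n, v) atTop (𝓝 v) :=
    (tendsto_const_nhds (x := v)).cesaro_smul
  refine ⟨x₀ + v, (hx₀.add hv).congr fun n => ?_⟩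
  rw [Finset.sum_add_distrib, smul_add]

/-- A continuous linear operator `T : E → F` between Banach spaces is
weakly Banach–Saks iff `T ∘ S` is a Banach–Saks operator for every weakly compact operator
`S` from any Banach space `G` into `E`.  (`w𝔅𝔖 = 𝔅𝔖 ∘ 𝔚⁻¹`.) -/
theorem weaklyBanachSaks_iff_comp_weaklyCompact_banachSaks
    (E F : Type) [BanachR E] [BanachR F] (T : E →L[ℝ] F) :
    WeaklyBanachSaksOp T ↔
      ∀ (G : Type) [BanachR G] (S : G →L[ℝ] E),
        WeaklyCompactOp S → BanachSaksOp (T.comp S) := by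
  constructor
  · intro hT G _ S hS x hx
    obtain ⟨R, hR, hxR⟩ := hx.exists_pos_norm_le
    have hball : ∀ n, R⁻¹ • x n ∈ closedBall (0 : G) 1 := fun n => by
      rw [mem_closedBall_zero_iff, norm_smul, norm_inv, Real.norm_of_nonneg hR.le,
        inv_mul_le_one₀ hR]
      exact hxR _ (mem_range_self n)
    obtain ⟨φ, hφ, x₀, hx₀⟩ := exists_weaklyConvergent_subseq hS (fun n => S (R⁻¹ • x n))
      fun n => subset_closure ⟨_, ⟨_, hball n, rfl⟩, rfl⟩
    have hconv : WeaklyConvergent (fun n => S (x (φ n))) (R • x₀) := fun f => by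
      rw [map_smul]
      refine ((hx₀ f).const_smul R).congr fun n => ?_
      simp only [map_smul, smul_inv_smul₀ hR.ne']
    obtain ⟨ψ, hψ, h⟩ := hT _ _ hconv
    exact ⟨φ ∘ ψ, hφ.comp hψ, h⟩
  · intro h x x₀ hx
    have hy : WeaklyConvergent (fun n => x n - x₀) 0 := fun f => by
      simpa using (hx f).sub_const (f x₀)
    obtain ⟨C, hC⟩ := hy.exists_norm_le
    obtain ⟨φ, hφ, hBS⟩ := h _ _ (weaklyCompactOp_l1Lift _ C hC hy)
      (fun n => lp.single 1 n 1) isBounded_range_l1_single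
    refine ⟨φ, hφ, ?_⟩
    simpa only [ContinuousLinearMap.comp_apply, l1Lift_single, map_sub, sub_add_cancel] using
      hBS.add_const (T x₀)
end

section
/- A continuous linear operator T : E → F between Banach spaces is weakly compact if and only if there exist a Banach space G, a Rosenthal compact operator S : E → G and a weakly sequentially complete operator R : G → F with T = R∘S. (In ideal notation: 𝔚 = w𝔖ℭ∘ℜ.) -/
open Filter Topology Bornology Metric Set

section EberleinSmulian

set_option maxSynthPendingDepth 3

variable {F : Type*} [NormedAddCommGroup F] [NormedSpace ℝ F]

/-- A finite-dimensional subspace of a dual space is `2`-normed by finitely many vectors of the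
unit ball of the predual. -/
theorem exists_finset_norming (V : Submodule ℝ (StrongDual ℝ F)) [FiniteDimensional ℝ V] :
    ∃ s : Finset F, (∀ x ∈ s, ‖x‖ ≤ 1) ∧ ∀ v ∈ V, v ≠ 0 → ∃ x ∈ s, ‖v‖ ≤ 2 * |v x| := by
  have hnorm : ∀ v : sphere (0 : V) 1, ∃ x : F, ‖x‖ ≤ 1 ∧ 1 / 2 < |(v : V).1 x| := by
    intro v
    have hv : ‖((v : V) : StrongDual ℝ F)‖ = 1 := mem_sphere_zero_iff_norm.1 v.2
    by_contra! h
    have := ContinuousLinearMap.opNorm_le_of_unit_norm (f := ((v : V) : StrongDual ℝ F))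
      (C := 1 / 2) (by norm_num) (fun x hx => h x hx.le)
    linarith
  choose x hx1 hx2 using hnorm
  obtain ⟨t, ht⟩ := (isCompact_univ (X := sphere (0 : V) 1)).elim_finite_subcover
    (fun v => {w : sphere (0 : V) 1 | 1 / 2 < |(w : V).1 (x v)|})
    (fun v => isOpen_lt continuous_const (continuous_abs.comp
      (((ContinuousLinearMap.apply ℝ ℝ (x v)).continuous.comp continuous_subtype_val).comp
        continuous_subtype_val)))
    (fun v _ => mem_iUnion.2 ⟨v, hx2 v⟩)
  classical
  refine ⟨t.image x, fun y hy => ?_, fun v hv hv0 => ?_⟩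
  · obtain ⟨v, -, rfl⟩ := Finset.mem_image.1 hy
    exact hx1 v
  have hpos : 0 < ‖v‖ := norm_pos_iff.2 hv0
  have hmem : (‖v‖⁻¹ • (⟨v, hv⟩ : V)) ∈ sphere (0 : V) 1 := by
    rw [mem_sphere_iff_norm, sub_zero, norm_smul, norm_inv, norm_norm]
    exact inv_mul_cancel₀ hpos.ne'
  obtain ⟨w, hw, hw'⟩ := mem_iUnion₂.1 (ht (mem_univ ⟨_, hmem⟩))
  refine ⟨x w, Finset.mem_image_of_mem _ hw, ?_⟩
  have h2 : 1 / 2 < |‖v‖⁻¹ * v (x w)| := hw'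
  rw [abs_mul, abs_of_pos (inv_pos.2 hpos), inv_mul_eq_div, lt_div_iff₀ hpos] at h2
  linarith

/-- A weak limit of a sequence lying in a closed subspace of the bidual lies in that subspace. -/
theorem inclusionInDoubleDual_mem_of_tendsto
    {Z : Submodule ℝ (StrongDual ℝ (StrongDual ℝ F))}
    (hZ : IsClosed (Z : Set (StrongDual ℝ (StrongDual ℝ F))))
    {a : ℕ → F} {y : F} (ha : ∀ n, NormedSpace.inclusionInDoubleDual ℝ F (a n) ∈ Z)
    (hy : ∀ f : StrongDual ℝ F, Tendsto (fun n => f (a n)) atTop (𝓝 (f y))) :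
    NormedSpace.inclusionInDoubleDual ℝ F y ∈ Z := by
  by_contra hmem
  obtain ⟨g, u, hg, hgy⟩ := geometric_hahn_banach_closed_point Z.convex hZ hmem
  have hlim := hy (g.comp (NormedSpace.inclusionInDoubleDual ℝ F))
  have := le_of_tendsto' hlim (fun n => (hg _ (ha n)).le)
  exact absurd hgy (not_lt.2 this)

/-- Whitley's argument: if every sequence of `W` has a weakly convergent subsequence, then every
weak-star cluster point of `W` in the bidual comes from the space itself. -/
theorem exists_eq_inclusionInDoubleDual_of_subseq {W : Set F}
    (hW : ∀ a : ℕ → F, (∀ n, a n ∈ W) → ∃ ψ : ℕ → ℕ, StrictMono ψ ∧ ∃ y : F,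
      ∀ f : StrongDual ℝ F, Tendsto (fun n => f (a (ψ n))) atTop (𝓝 (f y)))
    (φ : StrongDual ℝ (StrongDual ℝ F))
    (hφ : ∀ (s : Finset (StrongDual ℝ F)) (ε : ℝ), 0 < ε → ∃ a ∈ W, ∀ f ∈ s, |φ f - f a| < ε) :
    ∃ y, NormedSpace.inclusionInDoubleDual ℝ F y = φ := by
  classical
  set ι := NormedSpace.inclusionInDoubleDual ℝ F
  obtain ⟨p, hP, hr⟩ := exists_seq_of_forall_finset_exists
    (α := F × Submodule ℝ (StrongDual ℝ (StrongDual ℝ F)) × Finset (StrongDual ℝ F) × ℕ)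
    (fun p => p.1 ∈ W ∧ ι p.1 ∈ p.2.1 ∧ φ ∈ p.2.1 ∧ FiniteDimensional ℝ p.2.1 ∧
      (∀ f ∈ p.2.2.1, ‖f‖ ≤ 1) ∧ ∀ v ∈ p.2.1, v ≠ 0 → ∃ f ∈ p.2.2.1, ‖v‖ ≤ 2 * |v f|)
    (fun p q => p.2.1 ≤ q.2.1 ∧ (∀ f ∈ p.2.2.1, |φ f - f q.1| < 1 / ((q.2.2.2 : ℝ) + 1)) ∧
      p.2.2.2 < q.2.2.2) (by
    intro s hs
    set N : ℕ := s.sup (fun p => p.2.2.2) + 1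
    obtain ⟨a, haW, ha⟩ := hφ (s.biUnion (fun p => p.2.2.1)) (1 / ((N : ℝ) + 1)) (by positivity)
    set V : Submodule ℝ (StrongDual ℝ (StrongDual ℝ F)) :=
      (s.sup (fun p => p.2.1)) ⊔ Submodule.span ℝ {ι a, φ}
    have hsup : FiniteDimensional ℝ ↥(s.sup (fun p => p.2.1)) :=
      Finset.sup_induction (p := fun U : Submodule ℝ (StrongDual ℝ (StrongDual ℝ F)) =>
          FiniteDimensional ℝ U) (finiteDimensional_bot ℝ _)
        (fun _ _ _ _ => Submodule.finiteDimensional_sup _ _) (fun p hp => (hs p hp).2.2.2.1)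
    have hspan : FiniteDimensional ℝ (Submodule.span ℝ {ι a, φ}) :=
      FiniteDimensional.span_of_finite ℝ (toFinite _)
    have hVfin : FiniteDimensional ℝ V := Submodule.finiteDimensional_sup _ _
    obtain ⟨t, ht1, ht2⟩ := exists_finset_norming V
    have hmem : ∀ v ∈ ({ι a, φ} : Set (StrongDual ℝ (StrongDual ℝ F))), v ∈ V := fun v hv =>
      (le_sup_right : _ ≤ V) (Submodule.subset_span hv)
    refine ⟨(a, V, t, N), ⟨haW, hmem _ (by simp), hmem _ (by simp), hVfin, ht1, ht2⟩, ?_⟩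
    intro q hq
    exact ⟨(Finset.le_sup (f := fun p => p.2.1) hq).trans le_sup_left,
      fun f hf => ha f (Finset.mem_biUnion.2 ⟨q, hq, hf⟩),
      Nat.lt_succ_of_le (Finset.le_sup (f := fun p => p.2.2.2) hq)⟩)
  have hN : ∀ n, n ≤ (p n).2.2.2 := fun n =>
    (strictMono_nat_of_lt_succ (f := fun n => (p n).2.2.2)
      (fun n => (hr n (n + 1) n.lt_succ_self).2.2)).le_apply
  have hmono : Monotone (fun n => (p n).2.1) :=
    monotone_nat_of_le_succ (fun n => (hr n (n + 1) n.lt_succ_self).1)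
  obtain ⟨ψ, hψ, y, hy⟩ := hW (fun n => (p n).1) (fun n => (hP n).1)
  refine ⟨y, ?_⟩
  have hzero : ∀ m, ∀ f ∈ (p m).2.2.1, f y = φ f := by
    intro m f hf
    refine tendsto_nhds_unique (hy f) ?_
    have : Tendsto (fun n => f (p n).1) atTop (𝓝 (φ f)) := by
      rw [tendsto_iff_dist_tendsto_zero]
      refine squeeze_zero' (Eventually.of_forall fun _ => dist_nonneg) ?_
        tendsto_one_div_add_atTop_nhds_zero_nat
      filter_upwards [eventually_gt_atTop m] with n hn
      rw [dist_comm, Real.dist_eq]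
      refine ((hr m n hn).2.1 f hf).le.trans ?_
      have : (n : ℝ) ≤ (p n).2.2.2 := by exact_mod_cast hN n
      gcongr
    exact this.comp hψ.tendsto_atTop
  set Z : Submodule ℝ (StrongDual ℝ (StrongDual ℝ F)) := ⨆ n, (p n).2.1
  have hle : ∀ n, (p n).2.1 ≤ Z := fun n => le_iSup (fun n => (p n).2.1) n
  have hyZ : ι y ∈ Z.topologicalClosure :=
    inclusionInDoubleDual_mem_of_tendsto Z.isClosed_topologicalClosure
      (fun n => Z.le_topologicalClosure (hle _ (hP (ψ n)).2.1)) hy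
  have hdZ : ι y - φ ∈ Z.topologicalClosure :=
    sub_mem hyZ (Z.le_topologicalClosure (hle 0 (hP 0).2.2.1))
  rw [← sub_eq_zero, ← norm_le_zero_iff]
  refine le_of_forall_pos_le_add fun ε hε => ?_
  obtain ⟨z, hz, hdist⟩ := Metric.mem_closure_iff.1 hdZ (ε / 3) (by positivity)
  obtain ⟨m, hm⟩ := (Submodule.mem_iSup_of_directed _ hmono.directed_le).1 hz
  rw [dist_eq_norm] at hdist
  have hzn : ‖z‖ ≤ 2 * (ε / 3) := by
    rcases eq_or_ne z 0 with rfl | hz0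
    · simp; positivity
    obtain ⟨f, hf, hzf⟩ := (hP m).2.2.2.2.2 z hm hz0
    have h0 : (ι y - φ - z) f = - z f := by
      have : (ι y) f = f y := rfl
      simp [this, hzero m f hf]
    have h1 := (ι y - φ - z).le_opNorm f
    rw [h0, norm_neg, Real.norm_eq_abs] at h1
    have h2 := (hP m).2.2.2.2.1 f hf
    have h3 : ‖ι y - φ - z‖ * ‖f‖ ≤ ‖ι y - φ - z‖ := mul_le_of_le_one_right (norm_nonneg _) h2
    linarith
  have := norm_add_le (ι y - φ - z) z
  rw [sub_add_cancel] at this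
  linarith

/-- The hard half of the Eberlein–Šmulian theorem: a bounded set all of whose sequences have weakly
convergent subsequences is relatively weakly compact. -/
theorem isCompact_closure_toWeakSpace_of_subseq {W : Set F} (hb : IsBounded W)
    (hW : ∀ a : ℕ → F, (∀ n, a n ∈ W) → ∃ ψ : ℕ → ℕ, StrictMono ψ ∧ ∃ y : F,
      ∀ f : StrongDual ℝ F, Tendsto (fun n => f (a (ψ n))) atTop (𝓝 (f y))) :
    IsCompact (closure (toWeakSpace ℝ F '' W)) := by
  refine NormedSpace.isCompact_closure_of_isBounded ℝ F _ ?_ ?_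
  · rwa [preimage_image_eq _ (toWeakSpace ℝ F).injective]
  intro φ hφ
  obtain ⟨y, hy⟩ := exists_eq_inclusionInDoubleDual_of_subseq hW (WeakDual.toStrongDual φ) (by
    intro s ε hε
    have hopen : IsOpen (⋂ f ∈ s, {χ : WeakDual ℝ (StrongDual ℝ F) | |φ f - χ f| < ε}) :=
      isOpen_biInter_finset fun f _ => isOpen_lt
        ((continuous_const.sub (WeakDual.eval_continuous f)).abs) continuous_const
    obtain ⟨_, hχ, _, ⟨a, ha, rfl⟩, rfl⟩ := mem_closure_iff.1 hφ _ hopen (by simp [hε])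
    exact ⟨a, ha, fun f hf => mem_iInter₂.1 hχ f hf⟩)
  exact ⟨toWeakSpace ℝ F y, congrArg StrongDual.toWeakDual hy⟩

/-- The easy half of the Eberlein–Šmulian theorem: a sequence in a weakly compact set has a weakly
convergent subsequence. -/
theorem exists_subseq_tendsto_of_isCompact {C : Set (WeakSpace ℝ F)} (hC : IsCompact C)
    (y : ℕ → F) (hy : ∀ n, toWeakSpace ℝ F (y n) ∈ C) :
    ∃ ψ : ℕ → ℕ, StrictMono ψ ∧ ∃ y₀ : F,
      ∀ f : StrongDual ℝ F, Tendsto (fun n => f (y (ψ n))) atTop (𝓝 (f y₀)) := by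
  set Y : Submodule ℝ F := (Submodule.span ℝ (range y)).topologicalClosure
  have hYcl : IsClosed (toWeakSpace ℝ F '' (Y : Set F)) := by
    have h := Y.convex.toWeakSpace_closure (𝕜 := ℝ)
    rw [(Submodule.span ℝ (range y)).isClosed_topologicalClosure.closure_eq] at h
    rw [h]
    exact isClosed_closure
  have hsep : TopologicalSpace.IsSeparable (Y : Set F) :=
    (((countable_range y).isSeparable).span (R := ℝ)).closure
  have : TopologicalSpace.SeparableSpace Y := hsep.separableSpace
  choose g hg1 hg2 using fun n => exists_dual_vector'' ℝ (TopologicalSpace.denseSeq Y n : F)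
  set K := C ∩ toWeakSpace ℝ F '' (Y : Set F)
  have hK : IsCompact K := hC.inter_right hYcl
  have : CompactSpace K := isCompact_iff_compactSpace.1 hK
  have hcont : ∀ f : StrongDual ℝ F,
      Continuous (fun x : WeakSpace ℝ F => f ((toWeakSpace ℝ F).symm x)) :=
    fun f => WeakBilin.eval_continuous (topDualPairing ℝ F).flip f
  have hmet : TopologicalSpace.MetrizableSpace K := by
    refine Metric.PiNatEmbed.TopologicalSpace.MetrizableSpace.of_countable_separating
      (fun n (k : K) => g n ((toWeakSpace ℝ F).symm k))
      (fun n => (hcont (g n)).comp continuous_subtype_val) ?_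
    rintro ⟨_, _, ⟨u, hu, rfl⟩⟩ ⟨_, _, ⟨v, hv, rfl⟩⟩ huv
    by_contra! h
    refine huv (Subtype.ext (congrArg (toWeakSpace ℝ F) (sub_eq_zero.1 (norm_le_zero_iff.1 ?_))))
    refine le_of_forall_pos_le_add fun ε hε => ?_
    obtain ⟨n, hn⟩ := (TopologicalSpace.denseRange_denseSeq Y).exists_dist_lt
      (⟨u - v, sub_mem hu hv⟩ : Y) (half_pos hε)
    set d : F := ((TopologicalSpace.denseSeq Y n : Y) : F)
    have hn' : ‖u - v - d‖ < ε / 2 := by simpa [dist_eq_norm] using hn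
    have h0 : g n (u - v) = 0 := by
      rw [map_sub, sub_eq_zero]; exact h n
    have h1 : ‖d‖ ≤ ‖u - v - d‖ := by
      have h2 := (g n).le_of_opNorm_le (hg1 n) (u - v - d)
      have h3 : g n d = ‖d‖ := hg2 n
      rw [map_sub, h0, h3, zero_sub, norm_neg, norm_norm, one_mul] at h2
      exact h2
    have := norm_add_le (u - v - d) d
    rw [sub_add_cancel] at this
    linarith
  have hyY : ∀ n, y n ∈ Y := fun n =>
    Submodule.le_topologicalClosure _ (Submodule.subset_span (mem_range_self n))
  obtain ⟨y₀, ψ, hψ, hlim⟩ := CompactSpace.tendsto_subseq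
    (fun n => (⟨toWeakSpace ℝ F (y n), hy n, mem_image_of_mem _ (hyY n)⟩ : K))
  exact ⟨ψ, hψ, (toWeakSpace ℝ F).symm y₀, fun f =>
    (((hcont f).comp continuous_subtype_val).tendsto y₀).comp hlim⟩

end EberleinSmulian

section Factorization

set_option maxSynthPendingDepth 3

open scoped Pointwise

variable {E F : Type*} [NormedAddCommGroup E] [NormedSpace ℝ E]
  [NormedAddCommGroup F] [NormedSpace ℝ F]

/-- If `T` is weakly compact, then a bidual element dominated by `K ‖f ∘ T‖ + ε ‖f‖` lies within
`ε` of the image of `F`. -/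
theorem exists_norm_sub_inclusionInDoubleDual_le {T : E →L[ℝ] F}
    (hT : IsCompact (closure (toWeakSpace ℝ F '' (T '' closedBall 0 1))))
    (φ : StrongDual ℝ (StrongDual ℝ F)) {K ε : ℝ} (hK : 0 ≤ K) (hε : 0 ≤ ε)
    (hφ : ∀ f : StrongDual ℝ F, |φ f| ≤ K * ‖f.comp T‖ + ε * ‖f‖) :
    ∃ y : F, ‖φ - NormedSpace.inclusionInDoubleDual ℝ F y‖ ≤ ε := by
  set C := closure (toWeakSpace ℝ F '' (T '' closedBall 0 1))
  have hCconv : Convex ℝ C :=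
    ((((convex_closedBall (0 : E) 1).linear_image T.toLinearMap).linear_image
      (toWeakSpace ℝ F).toLinearMap)).closure
  set j := NormedSpace.inclusionInDoubleDualWeak ℝ F
  set B : Set (WeakDual ℝ (StrongDual ℝ F)) := WeakDual.toStrongDual ⁻¹' closedBall 0 ε
  set A : Set (WeakDual ℝ (StrongDual ℝ F)) := K • (j '' C) + B
  have hAcomp : IsCompact A :=
    ((hT.image j.continuous).smul K).add (WeakDual.isCompact_closedBall 0 ε)
  have hBconv : Convex ℝ B :=
    (convex_closedBall (0 : StrongDual ℝ (StrongDual ℝ F)) ε).is_linear_preimage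
      (f := WeakDual.toStrongDual) ⟨fun _ _ => rfl, fun _ _ => rfl⟩
  have hAconv : Convex ℝ A :=
    ((hCconv.linear_image j.toLinearMap).smul K).add hBconv
  by_cases hmem : StrongDual.toWeakDual φ ∈ A
  · obtain ⟨_, ⟨_, ⟨c, -, rfl⟩, rfl⟩, b, hb, hsum⟩ := hmem
    refine ⟨K • (toWeakSpace ℝ F).symm c, ?_⟩
    have hb' : ‖WeakDual.toStrongDual b‖ ≤ ε := mem_closedBall_zero_iff.1 hb
    convert hb' using 2
    rw [sub_eq_iff_eq_add', map_smul]
    exact hsum.symm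
  · exfalso
    have : LocallyConvexSpace ℝ (WeakDual ℝ (StrongDual ℝ F)) :=
      inferInstanceAs (LocallyConvexSpace ℝ (WeakBilin (topDualPairing ℝ (StrongDual ℝ F))))
    obtain ⟨g, u, hg, hgφ⟩ := geometric_hahn_banach_closed_point hAconv hAcomp.isClosed hmem
    obtain ⟨f, rfl⟩ := LinearMap.dualEmbedding_surjective
      (topDualPairing ℝ (StrongDual ℝ F)) g
    obtain ⟨z, hz1, hz2⟩ := exists_dual_vector'' ℝ f
    have hz2 : z f = ‖f‖ := hz2
    have key : ∀ e ∈ closedBall (0 : E) 1, K * f (T e) ≤ u - ε * ‖f‖ := by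
      intro e he
      have hmemA : K • j (toWeakSpace ℝ F (T e)) + StrongDual.toWeakDual (ε • z) ∈ A := by
        refine add_mem_add (smul_mem_smul_set (mem_image_of_mem _ (subset_closure
          (mem_image_of_mem _ (mem_image_of_mem _ he))))) ?_
        refine mem_closedBall_zero_iff.2 ?_
        change ‖ε • z‖ ≤ ε
        rw [norm_smul, Real.norm_of_nonneg hε]
        exact mul_le_of_le_one_right hε hz1
      have h1 := hg _ hmemA
      have h2 : K * f (T e) + ε * z f < u := h1
      rw [hz2] at h2
      linarith
    have hKf : ‖(K • f).comp T‖ ≤ u - ε * ‖f‖ := by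
      refine ContinuousLinearMap.opNorm_le_of_unit_norm (by simpa using key 0 (by simp)) ?_
      intro e he
      refine abs_le'.2 ⟨key e (by simp [he]), ?_⟩
      simpa using key (-e) (by simp [he])
    have hKf' : ‖(K • f).comp T‖ = K * ‖f.comp T‖ := by
      rw [ContinuousLinearMap.smul_comp, norm_smul, Real.norm_of_nonneg hK]
    have h3 : u < φ f := hgφ
    have h4 := hφ f
    have h5 := le_abs_self (φ f)
    linarith

/-- A uniformly bounded family of functionals assembles to a continuous map into `ℓ^∞`. -/
theorem exists_clm_lp_infty {I : Type*} (a : I → StrongDual ℝ E) (C : ℝ)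
    (h : ∀ i x, |a i x| ≤ C * ‖x‖) :
    ∃ A : E →L[ℝ] lp (fun _ : I => ℝ) ⊤, ∀ x i, A x i = a i x := by
  have hmem : ∀ x, Memℓp (fun i => a i x) ⊤ := fun x =>
    memℓp_infty ⟨C * ‖x‖, by rintro _ ⟨i, rfl⟩; exact h i x⟩
  let A : E →ₗ[ℝ] lp (fun _ : I => ℝ) ⊤ :=
    { toFun := fun x => ⟨fun i => a i x, hmem x⟩
      map_add' := fun x y => by ext i; exact map_add _ _ _
      map_smul' := fun c x => by ext i; exact map_smul _ _ _ }
  refine ⟨A.mkContinuous (max C 0) fun x => ?_, fun x i => rfl⟩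
  refine lp.norm_le_of_forall_le (by positivity) fun i => (h i x).trans ?_
  gcongr
  exact le_max_left _ _

/-- The `n`-th interpolation weight of a functional `f` relative to the operator `T`. -/
noncomputable def dualWeight (T : E →L[ℝ] F) (i : ℕ × StrongDual ℝ F) : ℝ :=
  (i.1 + 1) * ‖i.2.comp T‖ + 1 / (i.1 + 1) * ‖i.2‖

theorem dualWeight_nonneg (T : E →L[ℝ] F) (i : ℕ × StrongDual ℝ F) : 0 ≤ dualWeight T i := by
  unfold dualWeight; positivity

theorem abs_apply_le_dualWeight (T : E →L[ℝ] F) (i : ℕ × StrongDual ℝ F) (y : F) :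
    |i.2 y| ≤ (i.1 + 1) * ‖y‖ * dualWeight T i := by
  have h1 : |i.2 y| ≤ ‖i.2‖ * ‖y‖ := i.2.le_opNorm y
  have h2 : ((i.1 : ℝ) + 1) * ‖y‖ * (1 / (i.1 + 1) * ‖i.2‖) = ‖i.2‖ * ‖y‖ := by field_simp
  unfold dualWeight
  rw [mul_add, h2]
  exact h1.trans (le_add_of_nonneg_left (by positivity))

theorem abs_apply_comp_le_dualWeight (T : E →L[ℝ] F) (i : ℕ × StrongDual ℝ F) (x : E) :
    |i.2 (T x)| ≤ 1 / (i.1 + 1) * ‖x‖ * dualWeight T i := by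
  have h1 : |i.2 (T x)| ≤ ‖i.2.comp T‖ * ‖x‖ := (i.2.comp T).le_opNorm x
  have h2 : 1 / ((i.1 : ℝ) + 1) * ‖x‖ * ((i.1 + 1) * ‖i.2.comp T‖) = ‖i.2.comp T‖ * ‖x‖ := by
    field_simp
  unfold dualWeight
  rw [mul_add, h2]
  exact h1.trans (le_add_of_nonneg_right (by positivity))

/-- The interpolation space of `T`: the vectors `y` of `F` with `|f y| ≤ C * dualWeight T (n, f)`
for all `n` and `f`, presented as a closed subspace of `F × ℓ^∞`. -/
def interpolationSpace (T : E →L[ℝ] F) :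
    Submodule ℝ (F × lp (fun _ : ℕ × StrongDual ℝ F => ℝ) ⊤) where
  carrier := {p | ∀ i, p.2 i * dualWeight T i = i.2 p.1}
  add_mem' {p q} hp hq i := by
    change (p.2 i + q.2 i) * dualWeight T i = i.2 (p.1 + q.1)
    rw [add_mul, hp i, hq i, map_add]
  zero_mem' i := by
    change (0 : ℝ) * dualWeight T i = i.2 0
    simp
  smul_mem' c p hp i := by
    change c * p.2 i * dualWeight T i = i.2 (c • p.1)
    rw [mul_assoc, hp i, map_smul, smul_eq_mul]

theorem isClosed_interpolationSpace (T : E →L[ℝ] F) :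
    IsClosed (interpolationSpace T : Set (F × lp (fun _ : ℕ × StrongDual ℝ F => ℝ) ⊤)) := by
  have : (interpolationSpace T : Set (F × lp (fun _ : ℕ × StrongDual ℝ F => ℝ) ⊤)) =
      ⋂ i, {p | p.2 i * dualWeight T i = i.2 p.1} := by
    ext p; simp [interpolationSpace]
  rw [this]
  refine isClosed_iInter fun i => isClosed_eq (Continuous.mul_const ?_ _) (by fun_prop)
  refine (LipschitzWith.of_dist_le_mul (K := 1) fun p q => ?_ : LipschitzWith 1 fun
    p : F × lp (fun _ : ℕ × StrongDual ℝ F => ℝ) ⊤ => p.2 i).continuous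
  rw [NNReal.coe_one, one_mul, dist_eq_norm, dist_eq_norm]
  exact (lp.norm_apply_le_norm (by simp) (p.2 - q.2) i).trans (norm_snd_le (p - q))

/-- The inclusion of the interpolation space of `T` into `F`. -/
noncomputable def interpolationInclusion (T : E →L[ℝ] F) : interpolationSpace T →L[ℝ] F :=
  (ContinuousLinearMap.fst ℝ F _).comp (interpolationSpace T).subtypeL

/-- A pointwise limit of continuous functionals on a Banach space is a continuous functional. -/
theorem exists_strongDual_eq_of_tendsto [CompleteSpace E] (g : ℕ → StrongDual ℝ E) (c : E → ℝ)
    (h : ∀ x, Tendsto (fun n => g n x) atTop (𝓝 (c x))) :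
    ∃ φ : StrongDual ℝ E, ∀ x, φ x = c x :=
  ⟨continuousLinearMapOfTendsto g (tendsto_pi_nhds.2 h), fun _ => rfl⟩

/-- Weakly Cauchy sequences are bounded. -/
theorem exists_norm_le_of_weaklyCauchy (x : ℕ → E)
    (hx : ∀ g : StrongDual ℝ E, ∃ c, Tendsto (fun n => g (x n)) atTop (𝓝 c)) :
    ∃ M, ∀ n, ‖x n‖ ≤ M := by
  obtain ⟨M, hM⟩ := banach_steinhaus
    (g := fun n => NormedSpace.inclusionInDoubleDual ℝ E (x n)) (fun g => by
      obtain ⟨c, hc⟩ := hx g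
      obtain ⟨C, hC⟩ := hc.norm.bddAbove_range
      exact ⟨C, fun n => hC (mem_range_self n)⟩)
  exact ⟨M, fun n => ((NormedSpace.inclusionInDoubleDualLi (E := E) ℝ).norm_map
    (x n)).symm.le.trans (hM n)⟩

/-- The inclusion of the interpolation space of a weakly compact operator sends weakly Cauchy
sequences to weakly convergent sequences. -/
theorem interpolationInclusion_tendsto [CompleteSpace F] {T : E →L[ℝ] F}
    (hT : IsCompact (closure (toWeakSpace ℝ F '' (T '' closedBall 0 1))))
    (x : ℕ → interpolationSpace T)
    (hx : ∀ g : StrongDual ℝ (interpolationSpace T), ∃ c, Tendsto (fun n => g (x n)) atTop (𝓝 c)) :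
    ∃ y : F, ∀ f : StrongDual ℝ F,
      Tendsto (fun n => f (interpolationInclusion T (x n))) atTop (𝓝 (f y)) := by
  obtain ⟨M, hM⟩ := exists_norm_le_of_weaklyCauchy x hx
  have hM0 : 0 ≤ M := (norm_nonneg _).trans (hM 0)
  choose c hc using fun f : StrongDual ℝ F => hx (f.comp (interpolationInclusion T))
  obtain ⟨φ, hφ⟩ := exists_strongDual_eq_of_tendsto
    (fun n => NormedSpace.inclusionInDoubleDual ℝ F (interpolationInclusion T (x n))) c hc
  have hbound : ∀ i : ℕ × StrongDual ℝ F, |φ i.2| ≤ M * dualWeight T i := by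
    intro i
    rw [hφ]
    refine le_of_tendsto' (hc i.2).abs fun n => ?_
    have h1 : (x n).1.2 i * dualWeight T i = i.2 (x n).1.1 := (x n).2 i
    change |i.2 (x n).1.1| ≤ _
    rw [← h1, abs_mul, abs_of_nonneg (dualWeight_nonneg T i)]
    refine mul_le_mul_of_nonneg_right ?_ (dualWeight_nonneg T i)
    exact (lp.norm_apply_le_norm (by simp) (x n).1.2 i).trans
      ((norm_snd_le (x n).1).trans (hM n))
  have happrox : ∀ n : ℕ, ∃ y : F,
      ‖φ - NormedSpace.inclusionInDoubleDual ℝ F y‖ ≤ M * (1 / (n + 1)) := by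
    intro n
    refine exists_norm_sub_inclusionInDoubleDual_le hT φ (K := M * (n + 1)) (by positivity)
      (by positivity) fun f => (hbound (n, f)).trans_eq ?_
    simp only [dualWeight]
    ring
  have hmem : φ ∈ closure (range (NormedSpace.inclusionInDoubleDual ℝ F)) := by
    refine Metric.mem_closure_iff.2 fun ε hε => ?_
    have hlim : Tendsto (fun n : ℕ => M * (1 / ((n : ℝ) + 1))) atTop (𝓝 0) := by
      simpa using tendsto_one_div_add_atTop_nhds_zero_nat.const_mul M
    obtain ⟨n, hn⟩ := (hlim.eventually_lt_const hε).exists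
    obtain ⟨y, hy⟩ := happrox n
    exact ⟨_, mem_range_self y, by rw [dist_eq_norm]; exact hy.trans_lt hn⟩
  have hclosed : IsClosed (range (NormedSpace.inclusionInDoubleDual ℝ F)) :=
    (NormedSpace.inclusionInDoubleDualLi (E := F) ℝ).isometry.isClosedEmbedding.isClosed_range
  obtain ⟨y, hy⟩ := hclosed.closure_eq ▸ hmem
  refine ⟨y, fun f => ?_⟩
  have : f y = c f := by rw [← hφ, ← hy]; rfl
  rw [this]
  exact hc f

/-- A weakly compact operator factors through its interpolation space by an operator sending
bounded sequences to sequences with a weakly Cauchy subsequence. -/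
theorem exists_interpolation_factor {T : E →L[ℝ] F}
    (hT : IsCompact (closure (toWeakSpace ℝ F '' (T '' closedBall 0 1)))) :
    ∃ S : E →L[ℝ] interpolationSpace T, (∀ e, interpolationInclusion T (S e) = T e) ∧
      ∀ x : ℕ → E, IsBounded (range x) → ∃ ψ : ℕ → ℕ, StrictMono ψ ∧
        ∀ g : StrongDual ℝ (interpolationSpace T), ∃ c,
          Tendsto (fun n => g (S (x (ψ n)))) atTop (𝓝 c) := by
  obtain ⟨s, hs⟩ := exists_clm_lp_infty
    (fun i : ℕ × StrongDual ℝ F => (dualWeight T i)⁻¹ • i.2.comp T) 1 (by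
      intro i e
      change |(dualWeight T i)⁻¹ * i.2 (T e)| ≤ _
      rw [abs_mul, abs_inv, abs_of_nonneg (dualWeight_nonneg T i), inv_mul_eq_div]
      refine div_le_of_le_mul₀ (dualWeight_nonneg T i) (by positivity)
        ((abs_apply_comp_le_dualWeight T i e).trans ?_)
      have : 1 / ((i.1 : ℝ) + 1) ≤ 1 := by
        rw [div_le_one (by positivity)]; linarith [(Nat.cast_nonneg i.1 : (0 : ℝ) ≤ i.1)]
      have := dualWeight_nonneg T i
      gcongr)
  have hs' : ∀ e i, s e i = (dualWeight T i)⁻¹ * i.2 (T e) := hs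
  choose v hv using fun N : ℕ => exists_clm_lp_infty
    (fun i : ℕ × StrongDual ℝ F => if i.1 < N then (dualWeight T i)⁻¹ • i.2 else 0) N (by
      intro i y
      split_ifs with hi
      · change |(dualWeight T i)⁻¹ * i.2 y| ≤ _
        rw [abs_mul, abs_inv, abs_of_nonneg (dualWeight_nonneg T i), inv_mul_eq_div]
        refine div_le_of_le_mul₀ (dualWeight_nonneg T i) (by positivity)
          ((abs_apply_le_dualWeight T i y).trans ?_)
        have : (i.1 : ℝ) + 1 ≤ N := by exact_mod_cast hi
        have := dualWeight_nonneg T i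
        gcongr
      · simp; positivity)
  have happrox : ∀ N e, ‖s e - v N (T e)‖ ≤ 1 / ((N : ℝ) + 1) * ‖e‖ := by
    intro N e
    refine lp.norm_le_of_forall_le (by positivity) fun i => ?_
    change |s e i - v N (T e) i| ≤ _
    rw [hs', hv]
    split_ifs with hi
    · change |(dualWeight T i)⁻¹ * i.2 (T e) - (dualWeight T i)⁻¹ * i.2 (T e)| ≤ _
      rw [sub_self, abs_zero]
      positivity
    · change |(dualWeight T i)⁻¹ * i.2 (T e) - 0| ≤ _
      rw [sub_zero, abs_mul, abs_inv, abs_of_nonneg (dualWeight_nonneg T i), inv_mul_eq_div]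
      refine div_le_of_le_mul₀ (dualWeight_nonneg T i) (by positivity)
        ((abs_apply_comp_le_dualWeight T i e).trans ?_)
      have : (N : ℝ) ≤ i.1 := by exact_mod_cast not_lt.1 hi
      have := dualWeight_nonneg T i
      gcongr
  refine ⟨(T.prod s).codRestrict (interpolationSpace T) (fun e i => ?_), fun e => rfl, ?_⟩
  · change s e i * dualWeight T i = i.2 (T e)
    rw [hs']
    rcases eq_or_ne (dualWeight T i) 0 with h | h
    · have := abs_apply_le_dualWeight T i (T e)
      rw [h, mul_zero] at this
      rw [abs_nonpos_iff.1 this, h, mul_zero]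
    · field_simp
  intro x hx
  obtain ⟨M, hMpos, hM⟩ := hx.exists_pos_norm_le
  have hM : ∀ n, ‖x n‖ ≤ M := fun n => hM _ (mem_range_self n)
  obtain ⟨ψ, hψ, y, hy⟩ := exists_subseq_tendsto_of_isCompact hT (fun n => T (M⁻¹ • x n))
    (fun n => subset_closure (mem_image_of_mem _ (mem_image_of_mem _ (by
      rw [mem_closedBall_zero_iff, norm_smul, norm_inv, Real.norm_of_nonneg hMpos.le,
        inv_mul_le_one₀ hMpos]
      exact hM n))))
  have hT' : ∀ f : StrongDual ℝ F, Tendsto (fun n => f (T (x (ψ n)))) atTop (𝓝 (M * f y)) := by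
    intro f
    refine ((hy f).const_mul M).congr fun n => ?_
    simp [hMpos.ne']
  refine ⟨ψ, hψ, fun g => ?_⟩
  obtain ⟨L, hL, -⟩ := exists_extension_norm_eq (interpolationSpace T) g
  refine cauchySeq_tendsto_of_complete (Metric.cauchySeq_iff.2 fun ε hε => ?_)
  have hlim : Tendsto (fun N : ℕ => ‖L‖ * (1 / ((N : ℝ) + 1) * M)) atTop (𝓝 0) := by
    simpa using (tendsto_one_div_add_atTop_nhds_zero_nat.mul_const M).const_mul ‖L‖
  obtain ⟨N, hN⟩ := (hlim.eventually_lt_const (show 0 < ε / 3 by positivity)).exists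
  obtain ⟨n₀, hn₀⟩ := Metric.cauchySeq_iff.1
    (hT' (L.comp ((ContinuousLinearMap.id ℝ F).prod (v N)))).cauchySeq (ε / 3) (by positivity)
  have hclose : ∀ n, |L (T (x (ψ n)), s (x (ψ n))) - L (T (x (ψ n)), v N (T (x (ψ n))))| <
      ε / 3 := by
    intro n
    rw [← map_sub, Prod.mk_sub_mk, sub_self]
    refine (L.le_opNorm _).trans_lt (lt_of_le_of_lt ?_ hN)
    gcongr
    rw [Prod.norm_mk, norm_zero, max_eq_right (norm_nonneg _)]
    refine (happrox N _).trans ?_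
    gcongr
    exact hM _
  refine ⟨n₀, fun m hm n hn => ?_⟩
  rw [← hL, ← hL, Real.dist_eq]
  change |L (T (x (ψ m)), s (x (ψ m))) - L (T (x (ψ n)), s (x (ψ n)))| < ε
  have h1 := abs_lt.1 (hclose m)
  have h2 := abs_lt.1 (hclose n)
  have h3 : |L (T (x (ψ m)), v N (T (x (ψ m)))) - L (T (x (ψ n)), v N (T (x (ψ n))))| < ε / 3 :=
    hn₀ m hm n hn
  have h3 := abs_lt.1 h3
  exact abs_lt.2 ⟨by linarith, by linarith⟩

end Factorization

/-- A continuous linear operator `T : E → F` between Banach spaces is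
weakly compact iff it factors as `T = R ∘ S` with `S` Rosenthal compact and `R` a weakly
sequentially complete operator through some Banach space `G`.  (`𝔚 = w𝔖ℭ ∘ ℜ`.) -/
theorem weaklyCompact_iff_weaklySeqComplete_comp_rosenthal
    (E F : Type) [BanachR E] [BanachR F] (T : E →L[ℝ] F) :
    WeaklyCompactOp T ↔
      ∃ (G : Type) (_ : BanachR G) (S : E →L[ℝ] G) (R : G →L[ℝ] F),
        RosenthalCompactOp S ∧ WeaklySeqCompleteOp R ∧ T = R.comp S := by
  constructor
  · intro hT
    obtain ⟨S, hS, hrosenthal⟩ := exists_interpolation_factor hT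
    have : CompleteSpace (interpolationSpace T) :=
      (isClosed_interpolationSpace T).completeSpace_coe
    exact ⟨interpolationSpace T, {}, S, interpolationInclusion T, hrosenthal,
      fun x hx => ⟨id, strictMono_id, interpolationInclusion_tendsto hT x hx⟩,
      ContinuousLinearMap.ext fun e => (hS e).symm⟩
  · rintro ⟨G, _, S, R, hS, hR, rfl⟩
    refine isCompact_closure_toWeakSpace_of_subseq
      ((R.comp S).lipschitz.isBounded_image isBounded_closedBall) fun a ha => ?_
    choose x hx hxa using ha
    obtain ⟨ψ, hψ, hcauchy⟩ := hS x
      (isBounded_closedBall.subset (range_subset_iff.2 hx))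
    obtain ⟨χ, hχ, y, hy⟩ := hR _ hcauchy
    refine ⟨ψ ∘ χ, hψ.comp hχ, y, fun f => (hy f).congr fun n => ?_⟩
    exact congrArg f (hxa (ψ (χ n)))
end
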